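/- arXiv:2210.14371 — 2 statements merged into one kernel-verified Lean document; each statement's English description precedes it below -/
import Mathlib

section
/- Let A be a unital simple separable C*-algebra which is approximately divisible, of real rank zero, and stably finite, and assume that C(X,A) has strict comparison of positive elements with respect to tracial states for every compact metric space X. Let a ∈ A be a nonzero positive element with σ(a) ∩ (0, ε) ≠ ∅ for every ε > 0 (i.e., the Cuntz class of a is not compact). Let D_a = { b ∈ A : b ≥ 0 and b is Cuntz equivalent to a } with the subspace topology from A and basepoint a. Then D_a is path connected and for every k ≥ 1 the homotopy group π_k(D_a, a) is trivial. -/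
open Filter Topology

/-- Cuntz subequivalence: `a ≾ b` iff there is a sequence `vₙ` with `‖vₙ * b * vₙ* - a‖ → 0`. -/
def CuntzLE {B : Type*} [NonUnitalNormedRing B] [StarRing B] (a b : B) : Prop :=
  ∃ v : ℕ → B, Tendsto (fun n => ‖v n * b * star (v n) - a‖) atTop (𝓝 0)

/-- Cuntz equivalence: `a ≾ b` and `b ≾ a`. -/
def CuntzEquiv {B : Type*} [NonUnitalNormedRing B] [StarRing B] (a b : B) : Prop :=
  CuntzLE a b ∧ CuntzLE b a

/-- A projection: a self-adjoint idempotent. -/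
def IsProjection {B : Type*} [Mul B] [Star B] (p : B) : Prop :=
  star p = p ∧ p * p = p

/-- Murray–von Neumann equivalence of projections. -/
def MvNEquiv {B : Type*} [Mul B] [Star B] (p q : B) : Prop :=
  ∃ v : B, star v * v = p ∧ v * star v = q

/-- A tracial state on a unital C*-algebra: a unital positive linear functional `τ`
with `τ(xy) = τ(yx)`. -/
def IsTracialState {B : Type*} [CStarAlgebra B] [PartialOrder B] (τ : B → ℂ) : Prop :=
  (∀ x y : B, τ (x + y) = τ x + τ y) ∧ (∀ (c : ℂ) (x : B), τ (c • x) = c * τ x) ∧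
  τ 1 = 1 ∧ (∀ a : B, 0 ≤ a → 0 ≤ (τ a).re ∧ (τ a).im = 0) ∧
  (∀ x y : B, τ (x * y) = τ (y * x))

/-- The dimension function `d_τ(a) = lim_{n→∞} τ(a^{1/n})` associated to a tracial state,
with `a^{1/n}` given by the continuous functional calculus. -/
noncomputable def dTr {B : Type*} [CStarAlgebra B] (τ : B → ℂ) (a : B) : ℝ :=
  limUnder atTop (fun n : ℕ => (τ (cfc (fun t : ℝ => t ^ (n : ℝ)⁻¹) a)).re)

/-- Strict comparison of positive elements with respect to tracial states:
`a ≾ b` whenever `d_τ(a) < d_τ(b)` for every tracial state `τ`. -/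
def StrictComparison (B : Type*) [CStarAlgebra B] [PartialOrder B] : Prop :=
  ∀ a b : B, 0 ≤ a → 0 ≤ b →
    (∀ τ : B → ℂ, IsTracialState τ → dTr τ a < dTr τ b) → CuntzLE a b

/-- A unital C*-algebra is approximately divisible if for each `N` there is an
approximately central sequence of unital *-homomorphisms `M_N(ℂ) ⊕ M_{N+1}(ℂ) → A`. -/
def ApproxDivisible (A : Type*) [CStarAlgebra A] : Prop :=
  ∀ N : ℕ, ∃ φ : ℕ → ((Matrix (Fin N) (Fin N) ℂ × Matrix (Fin (N + 1)) (Fin (N + 1)) ℂ) →⋆ₐ[ℂ] A),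
    ∀ z, ∀ a : A, Tendsto (fun k => ‖φ k z * a - a * φ k z‖) atTop (𝓝 0)

/-- Real rank zero: every self-adjoint element is a norm limit of self-adjoint
elements with finite spectrum. -/
def RealRankZero (A : Type*) [CStarAlgebra A] : Prop :=
  ∀ a : A, IsSelfAdjoint a → ∀ ε : ℝ, 0 < ε →
    ∃ b : A, IsSelfAdjoint b ∧ (spectrum ℂ b).Finite ∧ ‖a - b‖ < ε

/-- Stably finite: every isometry in every matrix algebra over `A` is a unitary. -/
def StablyFinite (A : Type*) [CStarAlgebra A] : Prop :=
  ∀ n : ℕ, ∀ v : Matrix (Fin n) (Fin n) A, star v * v = 1 → v * star v = 1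

/-- Simplicity: no nontrivial closed two-sided ideals. -/
def CStarSimple (A : Type*) [CStarAlgebra A] : Prop :=
  ∀ I : TwoSidedIdeal A, IsClosed (I : Set A) → I = ⊥ ∨ I = ⊤

/-- The hereditary subalgebra generated by a positive element `f`: the norm closure
of `{ f x f : x ∈ B }`. -/
def herSet {B : Type*} [NonUnitalNormedRing B] (f : B) : Set B :=
  closure {y : B | ∃ x : B, y = f * x * f}

lemma cuntzLE_refl {B : Type*} [NormedRing B] [StarRing B] (a : B) : CuntzLE a a :=
  ⟨fun _ => 1, by simp⟩

lemma cuntzEquiv_refl {B : Type*} [NormedRing B] [StarRing B] (a : B) : CuntzEquiv a a :=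
  ⟨cuntzLE_refl a, cuntzLE_refl a⟩

section Cuntz

variable {B : Type*} [CStarAlgebra B]

lemma cuntzLE_iff_forall_exists_norm_lt {a b : B} :
    CuntzLE a b ↔ ∀ ε : ℝ, 0 < ε → ∃ v : B, ‖v * b * star v - a‖ < ε := by
  constructor
  · rintro ⟨v, hv⟩ ε hε
    obtain ⟨n, hn⟩ := (hv.eventually (gt_mem_nhds hε)).exists
    exact ⟨v n, hn⟩
  · intro h
    choose v hv using fun n : ℕ => h (1 / ((n : ℝ) + 1)) Nat.one_div_pos_of_nat
    exact ⟨v, squeeze_zero (fun _ => norm_nonneg _) (fun n => (hv n).le)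
      tendsto_one_div_add_atTop_nhds_zero_nat⟩

lemma cuntzLE_trans {a b c : B} (hab : CuntzLE a b) (hbc : CuntzLE b c) : CuntzLE a c := by
  rw [cuntzLE_iff_forall_exists_norm_lt] at *
  intro ε hε
  obtain ⟨v, hv⟩ := hab (ε / 2) (half_pos hε)
  have hK : 0 < ‖v‖ * ‖v‖ + 1 := by positivity
  obtain ⟨w, hw⟩ := hbc (ε / 2 / (‖v‖ * ‖v‖ + 1)) (by positivity)
  refine ⟨v * w, ?_⟩
  have h1 : v * w * c * star (v * w) - a
      = v * (w * c * star w - b) * star v + (v * b * star v - a) := by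
    rw [star_mul]; noncomm_ring
  have h2 : ‖v * (w * c * star w - b) * star v‖ ≤ ‖v‖ * ‖w * c * star w - b‖ * ‖v‖ := by
    refine (norm_mul_le _ _).trans ?_
    rw [norm_star]
    gcongr
    exact norm_mul_le _ _
  rw [lt_div_iff₀ hK] at hw
  have h3 : ‖v‖ * ‖w * c * star w - b‖ * ‖v‖ ≤ ‖w * c * star w - b‖ * (‖v‖ * ‖v‖ + 1) := by
    nlinarith [norm_nonneg (w * c * star w - b)]
  rw [h1]
  linarith [norm_add_le (v * (w * c * star w - b) * star v) (v * b * star v - a)]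

lemma cuntzLE_conj (v b : B) : CuntzLE (v * b * star v) b :=
  ⟨fun _ => v, by simp⟩

lemma cuntzLE_smul {r : ℝ} (hr : 0 ≤ r) (b : B) : CuntzLE (r • b) b := by
  have h : r • b = (√r • (1 : B)) * b * star (√r • (1 : B)) := by
    simp [smul_smul, Real.mul_self_sqrt hr]
  rw [h]
  exact cuntzLE_conj _ _

lemma cuntzLE_of_smul {r : ℝ} (hr : 0 < r) (b : B) : CuntzLE b (r • b) := by
  simpa [smul_smul, inv_mul_cancel₀ hr.ne'] using cuntzLE_smul (inv_nonneg.2 hr.le) (r • b)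

/-- Conjugation by an invertible element does not shrink the Cuntz class. -/
lemma cuntzLE_conj_of_isUnit {s : B} (hs : IsUnit s) (b : B) : CuntzLE b (s * b * star s) := by
  obtain ⟨u, rfl⟩ := hs
  have h := cuntzLE_conj (↑u⁻¹ : B) (u * b * star (u : B))
  have h2 : star (u : B) * star (↑u⁻¹ : B) = 1 := by rw [← star_mul]; simp
  rwa [show (↑u⁻¹ : B) * (u * b * star (u : B)) * star (↑u⁻¹ : B)
    = (↑u⁻¹ * u) * b * (star (u : B) * star (↑u⁻¹ : B)) by simp only [mul_assoc], h2,
    Units.inv_mul, one_mul, mul_one] at h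

/-- The positive part of `t - ε`. -/
noncomputable def cutoff (ε t : ℝ) : ℝ := max (t - ε) 0

@[fun_prop]
lemma continuous_cutoff (ε : ℝ) : Continuous (cutoff ε) := by unfold cutoff; fun_prop

/-- The functional calculus resolvent `(a + s)⁻¹`. -/
noncomputable def resolventAt (s : ℝ) (a : B) : B := cfc (fun t : ℝ => (t + s)⁻¹) a

lemma add_smul_one_eq_cfc {a : B} (ha : IsSelfAdjoint a) (s : ℝ) :
    a + s • (1 : B) = cfc (fun t : ℝ => t + s) a := by
  rw [cfc_add_const s (fun t => t) a, cfc_id' ℝ a, Algebra.algebraMap_eq_smul_one]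

lemma isSelfAdjoint_resolventAt (s : ℝ) (a : B) : IsSelfAdjoint (resolventAt s a) :=
  cfc_predicate _ _

variable [PartialOrder B] [StarOrderedRing B]

lemma continuousOn_inv_add {a : B} (ha : 0 ≤ a) {s : ℝ} (hs : 0 < s) :
    ContinuousOn (fun t : ℝ => (t + s)⁻¹) (spectrum ℝ a) :=
  ContinuousOn.inv₀ (by fun_prop) fun t ht => by
    have := spectrum_nonneg_of_nonneg ha ht
    positivity

lemma resolventAt_mul {a : B} (ha : 0 ≤ a) {s : ℝ} (hs : 0 < s) :
    resolventAt s a * (a + s • 1) = 1 := by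
  have h := continuousOn_inv_add ha hs
  rw [add_smul_one_eq_cfc ha.isSelfAdjoint, resolventAt, ← cfc_mul _ _ a h (by fun_prop),
    cfc_congr (g := fun _ => 1), cfc_const_one ℝ a]
  intro t ht
  have := spectrum_nonneg_of_nonneg ha ht
  exact inv_mul_cancel₀ (by positivity)

lemma mul_resolventAt {a : B} (ha : 0 ≤ a) {s : ℝ} (hs : 0 < s) :
    (a + s • 1) * resolventAt s a = 1 := by
  have h := resolventAt_mul ha hs
  rw [add_smul_one_eq_cfc ha.isSelfAdjoint, resolventAt] at h ⊢
  rwa [(cfc_commute_cfc _ _ a).eq]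

lemma resolventAt_mul_mul_resolventAt_norm_le {a : B} (ha : 0 ≤ a) {s : ℝ} (hs : 0 < s) :
    ‖resolventAt s a * a * resolventAt s a‖ ≤ s⁻¹ := by
  have h := continuousOn_inv_add ha hs
  have h1 : resolventAt s a * a * resolventAt s a
      = cfc (fun t : ℝ => (t + s)⁻¹ * t * (t + s)⁻¹) a := by
    rw [cfc_mul (fun t : ℝ => (t + s)⁻¹ * t) (fun t => (t + s)⁻¹) a (h.mul continuousOn_id) h,
      cfc_mul (fun t : ℝ => (t + s)⁻¹) (fun t => t) a h continuousOn_id, cfc_id' ℝ a, resolventAt]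
  rw [h1]
  refine norm_cfc_le (by positivity) fun t ht => ?_
  have h0 := spectrum_nonneg_of_nonneg ha ht
  have hts : 0 < t + s := by positivity
  rw [Real.norm_of_nonneg (by positivity), mul_assoc, inv_mul_le_iff₀ hts]
  calc t * (t + s)⁻¹ ≤ 1 := by rw [mul_inv_le_iff₀ hts]; linarith
    _ ≤ (t + s) * s⁻¹ := by rw [le_mul_inv_iff₀ hs]; linarith

/-- If `0 ≤ c ≤ d`, then `√c` lies in the closed left ideal generated by `d`. -/
lemma exists_tendsto_mul_sqrt {c d : B} (hc : 0 ≤ c) (hcd : c ≤ d) :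
    ∃ x : ℕ → B, Tendsto (fun n => x n * d) atTop (𝓝 (CFC.sqrt c)) := by
  have hd := hc.trans hcd
  refine ⟨fun n => CFC.sqrt c * resolventAt (1 / ((n : ℝ) + 1)) d, ?_⟩
  rw [tendsto_iff_norm_sub_tendsto_zero]
  have key : ∀ s : ℝ, 0 < s →
      ‖CFC.sqrt c * resolventAt s d * d - CFC.sqrt c‖ ≤ √s := by
    intro s hs
    set R := resolventAt s d with hR
    have hRs : star R = R := isSelfAdjoint_resolventAt s d
    have h1 : CFC.sqrt c * R * d - CFC.sqrt c = -(s • (CFC.sqrt c * R)) := by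
      have := resolventAt_mul hd hs
      rw [mul_add, mul_smul_comm, mul_one] at this
      rw [mul_assoc, eq_sub_of_add_eq this]
      simp [mul_sub, hR]
    have h2 : ‖CFC.sqrt c * R‖ * ‖CFC.sqrt c * R‖ ≤ s⁻¹ := by
      rw [← CStarRing.norm_star_mul_self, star_mul, hRs, (CFC.sqrt_nonneg c).isSelfAdjoint.star_eq]
      rw [show R * CFC.sqrt c * (CFC.sqrt c * R) = R * (CFC.sqrt c * CFC.sqrt c) * R by
        simp only [mul_assoc], CFC.sqrt_mul_sqrt_self c hc]
      refine le_trans (CStarAlgebra.norm_le_norm_of_nonneg_of_le ?_ ?_)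
        (resolventAt_mul_mul_resolventAt_norm_le hd hs)
      · simpa [hRs] using star_left_conjugate_nonneg hc R
      · simpa [hRs] using star_left_conjugate_le_conjugate hcd R
    rw [h1, norm_neg, norm_smul, Real.norm_of_nonneg hs.le]
    apply Real.le_sqrt_of_sq_le
    calc (s * ‖CFC.sqrt c * R‖) ^ 2 = s * s * (‖CFC.sqrt c * R‖ * ‖CFC.sqrt c * R‖) := by ring
      _ ≤ s * s * s⁻¹ := by gcongr
      _ = s := by field_simp
  refine squeeze_zero (fun _ => norm_nonneg _) (fun n => key _ Nat.one_div_pos_of_nat) ?_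
  have h := (Real.continuous_sqrt.tendsto 0).comp
    (tendsto_one_div_add_atTop_nhds_zero_nat (𝕜 := ℝ))
  rwa [Real.sqrt_zero] at h

lemma cuntzLE_mul_self_of_le {c d : B} (hc : 0 ≤ c) (hcd : c ≤ d) : CuntzLE c (d * d) := by
  obtain ⟨x, hx⟩ := exists_tendsto_mul_sqrt hc hcd
  refine ⟨x, ?_⟩
  rw [← tendsto_iff_norm_sub_tendsto_zero]
  have := hx.mul hx.star
  rw [(CFC.sqrt_nonneg c).isSelfAdjoint.star_eq, CFC.sqrt_mul_sqrt_self c hc] at this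
  refine this.congr fun n => ?_
  rw [star_mul, (hc.trans hcd).isSelfAdjoint.star_eq]
  simp only [mul_assoc]

lemma cuntzLE_of_le {c d : B} (hc : 0 ≤ c) (hcd : c ≤ d) : CuntzLE c d := by
  refine cuntzLE_trans (cuntzLE_mul_self_of_le hc hcd) ?_
  have hd := hc.trans hcd
  have h := cuntzLE_conj (CFC.sqrt d) d
  rw [(CFC.sqrt_nonneg d).isSelfAdjoint.star_eq] at h
  convert h using 1
  conv_lhs => rw [← CFC.sqrt_mul_sqrt_self d hd]
  conv_rhs => enter [1, 2]; rw [← CFC.sqrt_mul_sqrt_self d hd]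
  simp only [mul_assoc]

/-- Rørdam's lemma: cutting down an element makes it subequivalent to nearby elements. -/
lemma cuntzLE_cutoff_of_norm_sub_le {a b : B} (ha : 0 ≤ a) (hb : 0 ≤ b) {ε : ℝ}
    (h : ‖a - b‖ ≤ ε) : CuntzLE (cfc (cutoff ε) a) b := by
  set p := cfc (cutoff ε) a with hp
  have hp0 : 0 ≤ p := cfc_nonneg fun t _ => le_max_right _ _
  have hps : star p = p := hp0.isSelfAdjoint.star_eq
  have h1 : a - ε • (1 : B) ≤ b := by
    have h2 := (ha.isSelfAdjoint.sub hb.isSelfAdjoint).le_algebraMap_norm_self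
    have h3 : algebraMap ℝ B ‖a - b‖ ≤ algebraMap ℝ B ε := algebraMap_mono B h
    rw [Algebra.algebraMap_eq_smul_one ε] at h3
    rw [sub_le_comm]
    exact h2.trans h3
  have h2 : p * (a - ε • (1 : B)) * p = p * p * p := by
    have h3 : a - ε • (1 : B) = cfc (fun t : ℝ => t - ε) a := by
      simpa [sub_eq_add_neg] using add_smul_one_eq_cfc ha.isSelfAdjoint (-ε)
    rw [h3, hp, ← cfc_mul _ _ a, ← cfc_mul _ _ a, ← cfc_mul _ _ a, ← cfc_mul _ _ a]
    congr 1
    ext t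
    rcases le_total t ε with h | h
    · simp [cutoff, max_eq_right (sub_nonpos.2 h)]
    · simp [cutoff, max_eq_left (sub_nonneg.2 h)]
  have h3 : p * p * p ≤ p * b * p := by
    rw [← h2]
    simpa [hps] using star_left_conjugate_le_conjugate h1 p
  have h4 : 0 ≤ p * p * p := by simpa [hps] using star_left_conjugate_nonneg hp0 p
  have h5 : CuntzLE (p * p * p) b :=
    cuntzLE_trans (cuntzLE_of_le h4 h3) (by simpa [hps] using cuntzLE_conj p b)
  have hpp : 0 ≤ p * p := by simpa [hps] using star_mul_self_nonneg p
  refine cuntzLE_trans (cuntzLE_mul_self_of_le hp0 le_rfl)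
    (cuntzLE_trans (cuntzLE_mul_self_of_le hpp le_rfl) (cuntzLE_trans ?_ h5))
  have h := cuntzLE_conj (CFC.sqrt p) (p * p * p)
  rw [(CFC.sqrt_nonneg p).isSelfAdjoint.star_eq] at h
  convert h using 1
  have hq := CFC.sqrt_mul_sqrt_self p hp0
  generalize CFC.sqrt p = q at hq
  rw [← hq]
  simp only [mul_assoc]

lemma norm_cutoff_sub_le {a : B} (ha : 0 ≤ a) {ε : ℝ} (hε : 0 ≤ ε) :
    ‖cfc (cutoff ε) a - a‖ ≤ ε := by
  conv_lhs => enter [1, 2]; rw [← cfc_id' ℝ a]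
  rw [← cfc_sub _ _ a]
  refine norm_cfc_le hε fun t ht => ?_
  have h0 := spectrum_nonneg_of_nonneg ha ht
  rw [Real.norm_eq_abs, abs_le, cutoff]
  rcases le_total t ε with h | h
  · rw [max_eq_right (sub_nonpos.2 h)]; constructor <;> linarith
  · rw [max_eq_left (sub_nonneg.2 h)]; constructor <;> linarith

end Cuntz

section Trace

variable {B : Type*} [CStarAlgebra B]

/-- The element `a (a + s)⁻¹`. -/
noncomputable def regularize (s : ℝ) (a : B) : B := 1 - s • resolventAt s a

lemma isSelfAdjoint_regularize (s : ℝ) (a : B) : IsSelfAdjoint (regularize s a) :=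
  .sub (.one B) ((IsSelfAdjoint.all s).smul (isSelfAdjoint_resolventAt s a))

variable [PartialOrder B]

/-- A positive, not necessarily normalised, tracial functional. -/
structure IsPositiveTrace (τ : B → ℂ) : Prop where
  map_add : ∀ x y : B, τ (x + y) = τ x + τ y
  map_smul : ∀ (c : ℂ) (x : B), τ (c • x) = c * τ x
  nonneg : ∀ a : B, 0 ≤ a → 0 ≤ (τ a).re ∧ (τ a).im = 0
  map_mul_comm : ∀ x y : B, τ (x * y) = τ (y * x)

lemma IsTracialState.isPositiveTrace {τ : B → ℂ} (hτ : IsTracialState τ) : IsPositiveTrace τ :=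
  ⟨hτ.1, hτ.2.1, hτ.2.2.2.1, hτ.2.2.2.2⟩

lemma IsTracialState.map_one {τ : B → ℂ} (hτ : IsTracialState τ) : τ 1 = 1 := hτ.2.2.1

namespace IsPositiveTrace

variable {τ : B → ℂ}

lemma map_zero (hτ : IsPositiveTrace τ) : τ 0 = 0 := by simpa using hτ.map_smul 0 0

lemma map_neg (hτ : IsPositiveTrace τ) (x : B) : τ (-x) = -τ x := by
  simpa using hτ.map_smul (-1) x

lemma map_sub (hτ : IsPositiveTrace τ) (x y : B) : τ (x - y) = τ x - τ y := by
  rw [sub_eq_add_neg, hτ.map_add, hτ.map_neg, sub_eq_add_neg]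

lemma re_smul (hτ : IsPositiveTrace τ) (r : ℝ) (x : B) : (τ (r • x)).re = r * (τ x).re := by
  rw [show r • x = (r : ℂ) • x from (Complex.coe_smul r x).symm, hτ.map_smul,
    Complex.re_ofReal_mul]

lemma re_sum (hτ : IsPositiveTrace τ) {ι : Type*} (s : Finset ι) (f : ι → B) :
    (τ (∑ i ∈ s, f i)).re = ∑ i ∈ s, (τ (f i)).re := by
  classical
  induction s using Finset.induction_on with
  | empty => simp [hτ.map_zero]
  | insert i s hi ih => rw [Finset.sum_insert hi, Finset.sum_insert hi, hτ.map_add, Complex.add_re,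
      ih]

variable [StarOrderedRing B]

lemma re_mono (hτ : IsPositiveTrace τ) {x y : B} (h : x ≤ y) : (τ x).re ≤ (τ y).re := by
  have := (hτ.nonneg (y - x) (sub_nonneg.2 h)).1
  rw [hτ.map_sub, Complex.sub_re] at this
  linarith

lemma re_le_of_norm_le (hτ : IsPositiveTrace τ) {x : B} (hx : IsSelfAdjoint x)
    {r : ℝ} (h : ‖x‖ ≤ r) :
    (τ x).re ≤ r * (τ 1).re := by
  rw [← hτ.re_smul]
  refine hτ.re_mono ((hx.le_algebraMap_norm_self).trans ?_)
  rw [← Algebra.algebraMap_eq_smul_one]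
  exact algebraMap_mono B h

lemma re_le_add_of_norm_sub_le (hτ : IsPositiveTrace τ) {x y : B} (hx : IsSelfAdjoint x)
    (hy : IsSelfAdjoint y) {r : ℝ} (h : ‖x - y‖ ≤ r) : (τ x).re ≤ (τ y).re + r * (τ 1).re := by
  have := hτ.re_le_of_norm_le (hx.sub hy) h
  rw [hτ.map_sub, Complex.sub_re] at this
  linarith

end IsPositiveTrace

variable [StarOrderedRing B]

lemma spectrum_le_one_of_le_one {a : B} (ha : 0 ≤ a) (ha1 : a ≤ 1) {t : ℝ}
    (ht : t ∈ spectrum ℝ a) : t ≤ 1 := by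
  have h : a ≤ algebraMap ℝ B 1 := by simpa using ha1
  exact (le_algebraMap_iff_spectrum_le (ha := ha.isSelfAdjoint)).1 h t ht

lemma cfc_rpow_cfc {a : B} (ha : 0 ≤ a) {f : ℝ → ℝ} (hf : ContinuousOn f (spectrum ℝ a))
    {s : ℝ} (hs : 0 ≤ s) :
    cfc (fun t : ℝ => t ^ s) (cfc f a) = cfc (fun t => f t ^ s) a :=
  (cfc_comp' (fun t : ℝ => t ^ s) f a (Real.continuous_rpow_const hs).continuousOn hf).symm

namespace IsTracialState

variable {τ : B → ℂ}

lemma re_le_one (hτ : IsTracialState τ) {x : B} (hx : x ≤ 1) : (τ x).re ≤ 1 := by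
  simpa [hτ.map_one] using hτ.isPositiveTrace.re_mono hx

lemma rpow_mono_dTr (hτ : IsTracialState τ) {a : B} (ha : 0 ≤ a) (ha1 : a ≤ 1) :
    Monotone fun n : ℕ => (τ (cfc (fun t : ℝ => t ^ ((n + 1 : ℕ) : ℝ)⁻¹) a)).re := by
  intro m n hmn
  refine hτ.isPositiveTrace.re_mono (cfc_mono (fun t ht => ?_)
    (Real.continuous_rpow_const (by positivity)).continuousOn
    (Real.continuous_rpow_const (by positivity)).continuousOn)
  have h0 := spectrum_nonneg_of_nonneg ha ht
  exact Real.rpow_le_rpow_of_exponent_ge_of_imp h0 (spectrum_le_one_of_le_one ha ha1 ht)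
    (by gcongr) fun _ h => absurd h (by positivity)

lemma tendsto_dTr (hτ : IsTracialState τ) {a : B} (ha : 0 ≤ a) (ha1 : a ≤ 1) :
    Tendsto (fun n : ℕ => (τ (cfc (fun t : ℝ => t ^ ((n + 1 : ℕ) : ℝ)⁻¹) a)).re) atTop
      (𝓝 (dTr τ a)) := by
  have hbdd : BddAbove (Set.range fun n : ℕ =>
      (τ (cfc (fun t : ℝ => t ^ ((n + 1 : ℕ) : ℝ)⁻¹) a)).re) := by
    refine ⟨1, ?_⟩
    rintro _ ⟨n, rfl⟩
    refine hτ.re_le_one (cfc_le_one _ _ fun t ht => ?_)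
    exact Real.rpow_le_one (spectrum_nonneg_of_nonneg ha ht)
      (spectrum_le_one_of_le_one ha ha1 ht) (by positivity)
  have h := tendsto_atTop_ciSup (hτ.rpow_mono_dTr ha ha1) hbdd
  have h2 := (tendsto_add_atTop_iff_nat (f := fun n : ℕ =>
    (τ (cfc (fun t : ℝ => t ^ (n : ℝ)⁻¹) a)).re) 1).1 h
  rwa [dTr, h2.limUnder_eq]

lemma re_rpow_le_dTr (hτ : IsTracialState τ) {a : B} (ha : 0 ≤ a) (ha1 : a ≤ 1) (n : ℕ) :
    (τ (cfc (fun t : ℝ => t ^ ((n + 1 : ℕ) : ℝ)⁻¹) a)).re ≤ dTr τ a :=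
  (hτ.rpow_mono_dTr ha ha1).ge_of_tendsto (hτ.tendsto_dTr ha ha1) n

lemma re_le_dTr (hτ : IsTracialState τ) {a : B} (ha : 0 ≤ a) (ha1 : a ≤ 1) : (τ a).re ≤ dTr τ a := by
  have := hτ.re_rpow_le_dTr ha ha1 0
  simpa [cfc_id' ℝ a] using this

/-- The dimension function at `f(a)` is at most the trace of `g(a)` when `g` dominates the
indicator function of the support of `f`. -/
lemma dTr_cfc_le (hτ : IsTracialState τ) {a : B} (ha : 0 ≤ a)
    {f g : ℝ → ℝ} (hf : ContinuousOn f (spectrum ℝ a))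
    (hg : ContinuousOn g (spectrum ℝ a)) (hf0 : ∀ t ∈ spectrum ℝ a, 0 ≤ f t)
    (hf1 : ∀ t ∈ spectrum ℝ a, f t ≤ 1) (hg0 : ∀ t ∈ spectrum ℝ a, 0 ≤ g t)
    (h : ∀ t ∈ spectrum ℝ a, f t ≠ 0 → 1 ≤ g t) :
    dTr τ (cfc f a) ≤ (τ (cfc g a)).re := by
  refine le_of_tendsto' (hτ.tendsto_dTr (cfc_nonneg hf0) (cfc_le_one _ _ hf1)) fun n => ?_
  have hn : (0 : ℝ) < ((n + 1 : ℕ) : ℝ)⁻¹ := by positivity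
  rw [cfc_rpow_cfc ha hf hn.le]
  refine hτ.isPositiveTrace.re_mono (cfc_mono (fun t ht => ?_)
    (hf.rpow_const fun _ _ => Or.inr hn.le) hg)
  by_cases hft : f t = 0
  · rw [hft, Real.zero_rpow hn.ne']; exact hg0 t ht
  · exact (Real.rpow_le_one (hf0 t ht) (hf1 t ht) hn.le).trans (h t ht hft)

end IsTracialState

lemma regularize_eq_cfc {a : B} (ha : 0 ≤ a) {s : ℝ} (hs : 0 < s) :
    regularize s a = cfc (fun t : ℝ => 1 - s * (t + s)⁻¹) a := by
  have h := continuousOn_inv_add ha hs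
  rw [regularize, resolventAt, ← cfc_smul s _ a h, ← cfc_const_one ℝ a,
    ← cfc_sub (fun _ => 1) (fun t => s • (t + s)⁻¹) a (by fun_prop) (h.const_smul s)]
  rfl

lemma IsTracialState.re_regularize_le_dTr {τ : B → ℂ} (hτ : IsTracialState τ) {a : B} (ha : 0 ≤ a)
    (ha1 : a ≤ 1) {s : ℝ} (hs : 0 < s) : (τ (regularize s a)).re ≤ dTr τ a := by
  obtain ⟨n, hn⟩ := exists_nat_one_div_lt hs
  refine le_trans (hτ.isPositiveTrace.re_mono ?_) (hτ.re_rpow_le_dTr ha ha1 n)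
  rw [regularize_eq_cfc ha hs]
  set α : ℝ := ((n + 1 : ℕ) : ℝ)⁻¹ with hα
  have hα0 : 0 < α := by positivity
  have hα1 : α ≤ 1 := inv_le_one_of_one_le₀ (by simp)
  have hαs : α < s := by simpa [hα] using hn
  refine cfc_mono (fun t ht => ?_)
    (continuousOn_const.sub (continuousOn_const.mul (continuousOn_inv_add ha hs)))
    (Real.continuous_rpow_const hα0.le).continuousOn
  have h0 : 0 ≤ t := spectrum_nonneg_of_nonneg ha ht
  have hts : 0 < t + s := by positivity
  have h1 : 1 - s * (t + s)⁻¹ = t * (t + s)⁻¹ := by field_simp; ring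
  rw [h1]
  rcases h0.eq_or_lt with rfl | h0
  · rw [zero_mul]; positivity
  rw [mul_inv_le_iff₀ hts]
  have h2 := Real.geom_mean_le_arith_mean2_weighted (sub_nonneg.2 hα1) hα0.le h0.le zero_le_one
    (by ring)
  rw [Real.one_rpow, mul_one] at h2
  calc t = t ^ α * t ^ (1 - α) := by rw [← Real.rpow_add h0]; simp
    _ ≤ t ^ α * (t + s) := by gcongr; nlinarith

end Trace

section MatrixShift

open Matrix

/-- The upper shift matrix. -/
def upperShift (n : ℕ) : Matrix (Fin n) (Fin n) ℂ :=
  Matrix.of fun i j => if (i : ℕ) + 1 = j then 1 else 0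

/-- The diagonal matrix of powers of `t`. -/
def powDiagonal (n : ℕ) (t : ℂ) : Matrix (Fin n) (Fin n) ℂ := diagonal fun i => t ^ (i : ℕ)

/-- `t` times the inverse of `powDiagonal n t`. -/
noncomputable def coPowDiagonal (n : ℕ) (t : ℂ) : Matrix (Fin n) (Fin n) ℂ :=
  diagonal fun i => t * (t ^ (i : ℕ))⁻¹

lemma powDiagonal_mul_coPowDiagonal (n : ℕ) {t : ℂ} (ht : t ≠ 0) :
    powDiagonal n t * coPowDiagonal n t = t • 1 := by
  rw [powDiagonal, coPowDiagonal, diagonal_mul_diagonal, ← diagonal_one, ← diagonal_smul]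
  congr 1
  ext i
  simp
  field_simp

lemma powDiagonal_mul_upperShift_mul (n : ℕ) {t : ℂ} (ht : t ≠ 0) :
    powDiagonal n t * upperShift n * coPowDiagonal n t = upperShift n := by
  ext i j
  simp only [powDiagonal, coPowDiagonal, mul_diagonal, diagonal_mul, upperShift, of_apply]
  split_ifs with h
  · rw [← h, pow_succ]; field_simp
  · simp

lemma powDiagonal_mul_star_upperShift_mul (n : ℕ) {t : ℂ} (ht : t ≠ 0) :
    powDiagonal n t * star (upperShift n) * coPowDiagonal n t = t ^ 2 • star (upperShift n) := by
  ext i j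
  simp only [powDiagonal, coPowDiagonal, mul_diagonal, diagonal_mul, upperShift, of_apply,
    star_eq_conjTranspose, conjTranspose_apply, Matrix.smul_apply, smul_eq_mul]
  split_ifs with h
  · rw [← h, pow_succ, star_one]; field_simp
  · simp

lemma star_upperShift_mul (n : ℕ) :
    star (upperShift (n + 1)) * upperShift (n + 1) = 1 - single 0 0 1 := by
  ext i j
  simp only [upperShift, of_apply, star_eq_conjTranspose, mul_apply, conjTranspose_apply,
    Matrix.sub_apply, single_apply, one_apply]
  refine Fin.cases ?_ (fun i => ?_) i
  · simp
  · rw [Finset.sum_eq_single i.castSucc]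
    · simp [Fin.ext_iff, (Fin.succ_ne_zero i).symm]
    · intro b _ hb
      have : ¬ (b : ℕ) = i := fun h => hb (Fin.ext (by simpa using h))
      simp [this]
    · simp

/-- A shift in `M_N ⊕ M_{N+1}` which is an isometry up to a small projection and which survives,
unlike its adjoint, a degenerate diagonal conjugation. -/
lemma exists_shift_data (m : ℕ) :
    ∃ u e q : Matrix (Fin (m + 1)) (Fin (m + 1)) ℂ × Matrix (Fin (m + 1 + 1)) (Fin (m + 1 + 1)) ℂ,
    ∃ w : Fin (m + 1) →
      Matrix (Fin (m + 1)) (Fin (m + 1)) ℂ × Matrix (Fin (m + 1 + 1)) (Fin (m + 1 + 1)) ℂ,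
      star u * u = 1 - star e * e ∧ (∀ i, star (w i) * w i = star e * e) ∧
      star q * q + ∑ i, w i * star (w i) = 1 ∧
      ∀ t : ℂ, t ≠ 0 → ∃ d d' : Matrix (Fin (m + 1)) (Fin (m + 1)) ℂ ×
        Matrix (Fin (m + 1 + 1)) (Fin (m + 1 + 1)) ℂ,
        d * d' = t • 1 ∧ d * u * d' = u ∧ d * star u * d' = t ^ 2 • star u := by
  refine ⟨(upperShift _, upperShift _), (single 0 0 1, single 0 0 1),
    (0, single (Fin.last _) (Fin.last _) 1),
    fun i => (single i 0 1, single i.castSucc 0 1), ?_, fun i => ?_, ?_, fun t ht =>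
    ⟨(powDiagonal _ t, powDiagonal _ t), (coPowDiagonal _ t, coPowDiagonal _ t), ?_, ?_, ?_⟩⟩
  · refine Prod.ext ?_ ?_ <;> simp [star_eq_conjTranspose] <;>
      rw [← star_eq_conjTranspose, star_upperShift_mul]
  · refine Prod.ext ?_ ?_ <;> simp [star_eq_conjTranspose]
  · have h1 : ∀ n : ℕ, ∑ i : Fin n, single i i (1 : ℂ) = 1 := fun n => by
      simpa using (sum_single_eq_diagonal (fun _ : Fin n => (1 : ℂ)))
    refine Prod.ext ?_ ?_
    · simp [star_eq_conjTranspose, Prod.fst_sum, h1]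
    · have h2 := h1 (m + 1 + 1)
      rw [Fin.sum_univ_castSucc] at h2
      simpa [star_eq_conjTranspose, Prod.snd_sum] using (add_comm _ _).trans h2
  · exact Prod.ext (powDiagonal_mul_coPowDiagonal _ ht) (powDiagonal_mul_coPowDiagonal _ ht)
  · exact Prod.ext (powDiagonal_mul_upperShift_mul _ ht) (powDiagonal_mul_upperShift_mul _ ht)
  · exact Prod.ext (powDiagonal_mul_star_upperShift_mul _ ht)
      (powDiagonal_mul_star_upperShift_mul _ ht)

end MatrixShift

section Ramp

/-- The piecewise linear function vanishing below `δ` and equal to `1` above `2 * δ`. -/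
noncomputable def ramp (δ t : ℝ) : ℝ := max 0 (min 1 ((t - δ) / δ))

@[fun_prop]
lemma continuous_ramp (δ : ℝ) : Continuous (ramp δ) := by unfold ramp; fun_prop

lemma ramp_nonneg (δ t : ℝ) : 0 ≤ ramp δ t := le_max_left _ _

lemma ramp_le_one (δ t : ℝ) : ramp δ t ≤ 1 := max_le zero_le_one (min_le_left _ _)

lemma ramp_of_le {δ t : ℝ} (hδ : 0 < δ) (h : t ≤ δ) : ramp δ t = 0 :=
  max_eq_left ((min_le_right _ _).trans (div_nonpos_of_nonpos_of_nonneg (by linarith) hδ.le))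

lemma ramp_of_ge {δ t : ℝ} (hδ : 0 < δ) (h : 2 * δ ≤ t) : ramp δ t = 1 := by
  have h1 : 1 ≤ (t - δ) / δ := by rw [le_div_iff₀ hδ]; linarith
  rw [ramp, min_eq_left h1, max_eq_right zero_le_one]

lemma lt_of_ramp_ne_zero {δ t : ℝ} (hδ : 0 < δ) (h : ramp δ t ≠ 0) : δ < t :=
  not_le.1 fun h' => h (ramp_of_le hδ h')

variable {B : Type*} [CStarAlgebra B] [PartialOrder B] [StarOrderedRing B]

lemma cfc_ramp_nonneg (δ : ℝ) (a : B) : 0 ≤ cfc (ramp δ) a := cfc_nonneg fun _ _ => ramp_nonneg _ _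

lemma cfc_ramp_le_one (δ : ℝ) (a : B) : cfc (ramp δ) a ≤ 1 :=
  cfc_le_one _ _ fun _ _ => ramp_le_one _ _

lemma norm_le_one_of_le_one {x : B} (hx : 0 ≤ x) (hx1 : x ≤ 1) : ‖x‖ ≤ 1 :=
  (CStarAlgebra.norm_le_one_iff_of_nonneg x hx).2 hx1

lemma IsTracialState.re_ramp_le {τ : B → ℂ} (hτ : IsTracialState τ) {a : B} (ha : 0 ≤ a)
    {δ κ : ℝ} (hδ : 0 < δ) (hκ : 0 < κ) :
    (τ (cfc (ramp δ) a)).re ≤ (τ (regularize (κ * δ) a)).re + κ := by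
  have hs : 0 < κ * δ := by positivity
  have hc : ContinuousOn (fun t : ℝ => 1 - κ * δ * (t + κ * δ)⁻¹) (spectrum ℝ a) :=
    continuousOn_const.sub (continuousOn_const.mul (continuousOn_inv_add ha hs))
  have hfrac : ∀ t ∈ spectrum ℝ a, 1 - κ * δ * (t + κ * δ)⁻¹ = t * (t + κ * δ)⁻¹ := by
    intro t ht
    have h0 := spectrum_nonneg_of_nonneg ha ht
    field_simp
    ring
  have h1 : cfc (ramp δ) a ≤ (1 + κ) • regularize (κ * δ) a := by
    rw [regularize_eq_cfc ha hs, ← cfc_smul _ _ a hc]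
    refine cfc_mono (fun t ht => ?_) (by fun_prop)
      (continuousOn_const.mul hc)
    have h0 := spectrum_nonneg_of_nonneg ha ht
    rw [hfrac t ht, smul_eq_mul]
    by_cases h : ramp δ t = 0
    · rw [h]; positivity
    · have := lt_of_ramp_ne_zero hδ h
      refine (ramp_le_one _ _).trans ?_
      rw [← mul_assoc, ← div_eq_mul_inv, one_le_div (by positivity)]
      nlinarith
  have h2 : (τ (regularize (κ * δ) a)).re ≤ 1 := by
    refine hτ.re_le_one ?_
    rw [regularize_eq_cfc ha hs]
    refine cfc_le_one _ _ fun t ht => ?_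
    have h0 := spectrum_nonneg_of_nonneg ha ht
    simp only [sub_le_self_iff]
    positivity
  have h3 := hτ.isPositiveTrace.re_mono h1
  rw [hτ.isPositiveTrace.re_smul] at h3
  nlinarith

/-- The spectrum of `a` near `0` carries uniformly positive trace. -/
def HasTraceGaps (a : B) : Prop :=
  ∀ ε : ℝ, 0 < ε → ∃ δ γ : ℝ, 0 < δ ∧ 0 < γ ∧ ∀ τ : B → ℂ, IsTracialState τ →
    (τ (cfc (ramp ε) a)).re + γ ≤ (τ (cfc (ramp δ) a)).re

/-- A uniform comparison of the traces of regularizations. -/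
def TraceDominated (a g : B) : Prop :=
  ∀ s κ : ℝ, 0 < s → 0 < κ → ∃ s' : ℝ, 0 < s' ∧ ∀ τ : B → ℂ, IsTracialState τ →
    (τ (regularize s a)).re ≤ (τ (regularize s' g)).re + κ

lemma cuntzLE_ramp (hSC : StrictComparison B) {a g : B} (ha : 0 ≤ a) (hg : 0 ≤ g) (hg1 : g ≤ 1)
    (hgap : HasTraceGaps a) (hdom : TraceDominated a g) {δ : ℝ} (hδ : 0 < δ) :
    CuntzLE (cfc (ramp δ) a) g := by
  obtain ⟨δ', γ, hδ', hγ, h1⟩ := hgap (δ / 2) (half_pos hδ)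
  obtain ⟨s', hs', h2⟩ := hdom (γ / 4 * δ') (γ / 4) (by positivity) (by positivity)
  refine hSC _ _ (cfc_ramp_nonneg _ _) hg fun τ hτ => ?_
  have h3 : dTr τ (cfc (ramp δ) a) ≤ (τ (cfc (ramp (δ / 2)) a)).re :=
    hτ.dTr_cfc_le ha (by fun_prop) (by fun_prop) (fun _ _ => ramp_nonneg _ _)
      (fun _ _ => ramp_le_one _ _) (fun _ _ => ramp_nonneg _ _) fun t _ h =>
      (ramp_of_ge (half_pos hδ) (by linarith [lt_of_ramp_ne_zero hδ h])).ge
  have h4 := hτ.re_ramp_le ha hδ' (by positivity : 0 < γ / 4)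
  have h5 := hτ.re_regularize_le_dTr hg hg1 hs'
  linarith [h1 τ hτ, h2 τ hτ]

lemma exists_norm_sqrt_mul_sub_ramp_le {a g : B} (ha : 0 ≤ a) (hg : 0 ≤ g) {δ η : ℝ} (hδ : 0 < δ)
    (hη : 0 < η) (h : CuntzLE (cfc (ramp δ) a) g) :
    ∃ w : B, ‖CFC.sqrt a * w * CFC.sqrt g * star (CFC.sqrt a * w * CFC.sqrt g)
      - cfc (ramp δ) a‖ ≤ η := by
  obtain ⟨v, hv⟩ := cuntzLE_iff_forall_exists_norm_lt.1 h η hη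
  have hpos : ∀ t, 0 < max t δ := fun t => lt_max_of_lt_right hδ
  obtain ⟨χ, hχc, hχ⟩ : ∃ χ : ℝ → ℝ, Continuous χ ∧ ∀ t, χ t = (√(max t δ))⁻¹ :=
    ⟨_, Continuous.inv₀ (by fun_prop) fun t => (Real.sqrt_pos.2 (hpos t)).ne', fun _ => rfl⟩
  have hsa : CFC.sqrt a = cfc Real.sqrt a := by
    rw [CFC.sqrt_eq_real_sqrt a, cfcₙ_eq_cfc]
  set c := CFC.sqrt a * cfc χ a with hc
  have hc' : c = cfc (fun t => √t * χ t) a := by rw [hc, hsa, ← cfc_mul _ _ a]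
  have hcs : star c = c := by rw [hc']; exact (cfc_predicate (R := ℝ) (p := IsSelfAdjoint) _ a).star_eq
  have hcn : ‖c‖ ≤ 1 := by
    rw [hc']
    refine norm_cfc_le zero_le_one fun t _ => ?_
    rw [hχ, Real.norm_of_nonneg (by positivity), ← div_eq_mul_inv,
      div_le_one (Real.sqrt_pos.2 (hpos t))]
    exact Real.sqrt_le_sqrt (le_max_left _ _)
  have hcr : c * cfc (ramp δ) a * c = cfc (ramp δ) a := by
    rw [hc', ← cfc_mul _ _ a, ← cfc_mul _ _ a]
    refine cfc_congr fun t ht => ?_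
    by_cases h0 : ramp δ t = 0
    · simp [h0]
    · have h1 := lt_of_ramp_ne_zero hδ h0
      have h2 : √t * χ t = 1 := by
        rw [hχ, max_eq_left h1.le]
        exact mul_inv_cancel₀ (Real.sqrt_pos.2 (hδ.trans h1)).ne'
      simp [h2]
  refine ⟨cfc χ a * v, ?_⟩
  have hg2 := CFC.sqrt_mul_sqrt_self g hg
  have hgs : star (CFC.sqrt g) = CFC.sqrt g := (CFC.sqrt_nonneg g).isSelfAdjoint
  have e1 : CFC.sqrt a * (cfc χ a * v) * CFC.sqrt g
      * star (CFC.sqrt a * (cfc χ a * v) * CFC.sqrt g) - cfc (ramp δ) a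
      = c * (v * g * star v - cfc (ramp δ) a) * c := by
    rw [mul_sub, sub_mul, hcr, ← mul_assoc, ← hc, star_mul, star_mul, hcs, hgs]
    nth_rw 3 [← hg2]
    simp only [mul_assoc]
  rw [e1]
  calc ‖c * (v * g * star v - cfc (ramp δ) a) * c‖
      ≤ ‖c‖ * ‖v * g * star v - cfc (ramp δ) a‖ * ‖c‖ :=
        (norm_mul_le _ _).trans (by gcongr; exact norm_mul_le _ _)
    _ ≤ 1 * η * 1 := by gcongr
    _ = η := by ring

lemma cuntzLE_cutoff_shift (hSC : StrictComparison B) {a : B} (ha : 0 ≤ a) (ha1 : a ≤ 1)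
    {ε δ η γ κ : ℝ} (hε : 0 < ε) (hη : 0 ≤ η) (hκ : κ + η < γ)
    (hgap : ∀ τ : B → ℂ, IsTracialState τ →
      (τ (cfc (ramp (ε / 2)) a)).re + γ ≤ (τ (cfc (ramp δ) a)).re)
    {u e : B} (hue : star u * u = 1 - star e * e)
    (he : ∀ τ : B → ℂ, IsTracialState τ → (τ (star e * e)).re ≤ κ) :
    CuntzLE (cfc (cutoff ε) a) (cfc (cutoff η) (u * cfc (ramp δ) a * star u)) := by
  set r := cfc (ramp δ) a with hr
  have hr0 : 0 ≤ r := cfc_ramp_nonneg _ _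
  have hr1 : r ≤ 1 := cfc_ramp_le_one _ _
  have hq0 : 0 ≤ u * r * star u := star_right_conjugate_nonneg hr0 u
  have hu1 : star u * u ≤ 1 := by rw [hue]; exact sub_le_self _ (star_mul_self_nonneg e)
  have hun : ‖u‖ ≤ 1 := by
    have := norm_le_one_of_le_one (star_mul_self_nonneg u) hu1
    rw [CStarRing.norm_star_mul_self] at this
    nlinarith [norm_nonneg u]
  have huu : u * star u ≤ 1 := by
    rw [← CStarAlgebra.norm_le_one_iff_of_nonneg _ (mul_star_self_nonneg u),
      CStarRing.norm_self_mul_star]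
    nlinarith [norm_nonneg u]
  have hq1 : u * r * star u ≤ 1 := by
    refine le_trans ?_ huu
    simpa using star_right_conjugate_le_conjugate hr1 u
  refine hSC _ _ (cfc_nonneg fun _ _ => le_max_right _ _) (cfc_nonneg fun _ _ => le_max_right _ _)
    fun τ hτ => ?_
  have h1 : dTr τ (cfc (cutoff ε) a) ≤ (τ (cfc (ramp (ε / 2)) a)).re := by
    refine hτ.dTr_cfc_le ha (by fun_prop) (by fun_prop) (fun _ _ => le_max_right _ _)
      (fun t ht => max_le ?_ zero_le_one) (fun _ _ => ramp_nonneg _ _) fun t _ h =>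
      (ramp_of_ge (half_pos hε) ?_).ge
    · linarith [spectrum_le_one_of_le_one ha ha1 ht]
    · by_contra! h'
      exact h (max_eq_right (by linarith))
  have h2 : (τ (cfc (cutoff η) (u * r * star u))).re ≤ dTr τ (cfc (cutoff η) (u * r * star u)) :=
    hτ.re_le_dTr (cfc_nonneg fun _ _ => le_max_right _ _)
      (cfc_le_one _ _ fun t ht => max_le (by linarith [spectrum_le_one_of_le_one hq0 hq1 ht])
        zero_le_one)
  have h3 : (τ (u * r * star u)).re ≤ (τ (cfc (cutoff η) (u * r * star u))).re + η := by
    have := hτ.isPositiveTrace.re_le_add_of_norm_sub_le hq0.isSelfAdjoint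
      (cfc_predicate (cutoff η) (u * r * star u))
      ((norm_sub_rev _ _).trans_le (norm_cutoff_sub_le hq0 hη))
    simpa [hτ.map_one] using this
  have h4 : (τ (u * r * star u)).re = (τ r).re - (τ (e * r * star e)).re := by
    rw [hτ.isPositiveTrace.map_mul_comm, ← mul_assoc, hue, sub_mul, one_mul,
      hτ.isPositiveTrace.map_sub, Complex.sub_re, mul_assoc, hτ.isPositiveTrace.map_mul_comm]
  have h5 : (τ (e * r * star e)).re ≤ κ := by
    have h := he τ hτ
    rw [hτ.isPositiveTrace.map_mul_comm] at h
    refine le_trans (hτ.isPositiveTrace.re_mono ?_) h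
    simpa using star_right_conjugate_le_conjugate hr1 e
  linarith [hgap τ hτ]

end Ramp

section NullSequences

variable {B : Type*} [NormedRing B]

lemma tendsto_zero_mul_of_bounded {f g : ℕ → B} (hf : Tendsto f atTop (𝓝 0)) {C : ℝ}
    (hg : ∀ j, ‖g j‖ ≤ C) : Tendsto (fun j => f j * g j) atTop (𝓝 0) :=
  hf.zero_mul_isBoundedUnder_le (isBoundedUnder_of ⟨C, hg⟩)

lemma bounded_mul_tendsto_zero {f g : ℕ → B} {C : ℝ} (hf : ∀ j, ‖f j‖ ≤ C)
    (hg : Tendsto g atTop (𝓝 0)) : Tendsto (fun j => f j * g j) atTop (𝓝 0) :=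
  isBoundedUnder_le_mul_tendsto_zero (isBoundedUnder_of ⟨C, hf⟩) hg

lemma norm_mul_le_of_norm_le {x y : B} {c d : ℝ} (hx : ‖x‖ ≤ c) (hy : ‖y‖ ≤ d) :
    ‖x * y‖ ≤ c * d :=
  (norm_mul_le x y).trans (mul_le_mul hx hy (norm_nonneg _) ((norm_nonneg _).trans hx))

end NullSequences

section NormBound

open scoped Matrix.Norms.L2Operator

lemma exists_norm_map_le {m n : ℕ} (z : Matrix (Fin m) (Fin m) ℂ × Matrix (Fin n) (Fin n) ℂ) :
    ∃ C : ℝ, ∀ {B : Type*} [CStarAlgebra B]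
      (φ : (Matrix (Fin m) (Fin m) ℂ × Matrix (Fin n) (Fin n) ℂ) →⋆ₐ[ℂ] B), ‖φ z‖ ≤ C :=
  ⟨‖z‖, fun φ => NonUnitalStarAlgHom.norm_apply_le φ z⟩

end NormBound

section Identities

variable {R : Type*} [Ring R] [Algebra ℂ R] {d d' u v : R} {t : ℂ}

lemma conj_eq_add_commutator (h1 : d * d' = t • 1) (x : R) :
    d * x * d' = t • x + d * (x * d' - d' * x) := by
  have : d * (d' * x) = t • x := by rw [← mul_assoc, h1, smul_mul_assoc, one_mul]
  rw [mul_sub, this]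
  noncomm_ring

lemma conj_mul_mul_eq_add_commutator {c : ℂ} (h2 : d * u * d' = c • u) (x y : R) :
    d * (x * u * y) * d' = c • (x * u * y) + (d * x * u * (y * d' - d' * y)
      + (d * x - x * d) * u * d' * y) := by
  have : x * (d * u * d') * y = c • (x * u * y) := by rw [h2]; simp
  rw [← this]
  noncomm_ring

end Identities

section Perturbation

variable {B : Type*} [CStarAlgebra B]

lemma norm_mul_star_sub_le {z y q : B} {θ η : ℝ} (hθ : ‖z - y‖ ≤ θ) (hθ1 : θ ≤ 1)
    (hq : ‖y * star y - q‖ ≤ η) : ‖z * star z - q‖ ≤ θ * (2 * ‖y‖ + 1) + η := by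
  have h1 : z * star z - q = (z - y) * star (z - y) + ((z - y) * star y + y * star (z - y))
      + (y * star y - q) := by
    rw [star_sub]; noncomm_ring
  have h0 := norm_nonneg (z - y)
  have h2 : ‖(z - y) * star (z - y)‖ ≤ θ * 1 :=
    norm_mul_le_of_norm_le hθ (by rw [norm_star]; linarith)
  have h3 : ‖(z - y) * star y‖ ≤ θ * ‖y‖ := norm_mul_le_of_norm_le hθ (norm_star y).le
  have h4 : ‖y * star (z - y)‖ ≤ ‖y‖ * θ := norm_mul_le_of_norm_le le_rfl (by rwa [norm_star])
  rw [h1]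
  have := norm_add₃_le (a := (z - y) * star (z - y))
    (b := (z - y) * star y + y * star (z - y)) (c := y * star y - q)
  linarith [norm_add_le ((z - y) * star y) (y * star (z - y))]

variable [PartialOrder B] [StarOrderedRing B]

lemma norm_le_one_of_star_mul_self {u e : B} (h : star u * u = 1 - star e * e) : ‖u‖ ≤ 1 := by
  have := norm_le_one_of_le_one (star_mul_self_nonneg u)
    (by rw [h]; exact sub_le_self _ (star_mul_self_nonneg e))
  rw [CStarRing.norm_star_mul_self] at this
  nlinarith [norm_nonneg u]

/-- A small perturbation of `k` makes `E k h` close, after compression by degenerate matrix units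
almost commuting with everything, to a shift times a prescribed `E w h`. -/
lemma exists_perturbation (hAD : ApproxDivisible B) (E h k w : B) (m : ℕ) {ρ θ : ℝ} (hρ : 0 < ρ)
    (hθ : 0 < θ) :
    ∃ u e d d' : B, star u * u = 1 - star e * e ∧
      (∀ τ : B → ℂ, IsTracialState τ → (τ (star e * e)).re ≤ 1 / ((m : ℝ) + 1)) ∧
      ‖d * (E * (k + ρ • (u * w + star (u * w))) * h) * d' - u * (E * w * h)‖ ≤ θ := by
  obtain ⟨U, e, q, W, hU, hW, hq, hD⟩ := exists_shift_data m
  obtain ⟨φ, hφ⟩ := hAD (m + 1)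
  have hcomm : ∀ z (x : B), Tendsto (fun j => φ j z * x - x * φ j z) atTop (𝓝 0) := fun z x =>
    tendsto_zero_iff_norm_tendsto_zero.2 (hφ z x)
  have hcomm' : ∀ z (x : B), Tendsto (fun j => x * φ j z - φ j z * x) atTop (𝓝 0) := fun z x => by
    simpa using (hcomm z x).neg
  set K : ℝ := ρ⁻¹ * ‖E * k * h‖ + ‖E * star w‖ * ‖h‖ with hK
  have hK0 : 0 ≤ K := by positivity
  set t : ℝ := min 1 (θ / (2 * (K + 1))) with ht
  have ht0 : 0 < t := lt_min one_pos (by positivity)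
  have htK : t * K ≤ θ / 2 := by
    have h1 : t * (2 * (K + 1)) ≤ θ := (le_div_iff₀ (by positivity)).1 (min_le_right _ _)
    nlinarith
  obtain ⟨D, D', hDD, hDU, hDU'⟩ := hD (t : ℂ) (by exact_mod_cast ht0.ne')
  obtain ⟨CD, hCD⟩ := exists_norm_map_le.{_} D
  obtain ⟨CD', hCD'⟩ := exists_norm_map_le.{_} D'
  obtain ⟨CU, hCU⟩ := exists_norm_map_le.{_} U
  have bD : ∀ j, ‖φ j D‖ ≤ CD := fun j => hCD (φ j)
  have bD' : ∀ j, ‖φ j D'‖ ≤ CD' := fun j => hCD' (φ j)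
  have bU : ∀ j, ‖φ j U‖ ≤ CU := fun j => hCU (φ j)
  have bU' : ∀ j, ‖star (φ j U)‖ ≤ CU := fun j => (norm_star _).trans_le (bU j)
  have bc : ∀ x : B, ∀ j : ℕ, ‖x‖ ≤ ‖x‖ := fun _ _ => le_rfl
  have mul_bound : ∀ {f g : ℕ → B} {c c' : ℝ}, (∀ j, ‖f j‖ ≤ c) → (∀ j, ‖g j‖ ≤ c') →
      ∀ j, ‖f j * g j‖ ≤ c * c' := fun hf hg j => norm_mul_le_of_norm_le (hf j) (hg j)
  have hu : ∀ j, star (φ j U) * φ j U = 1 - star (φ j e) * φ j e := fun j => by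
    rw [← map_star, ← map_mul, hU, map_sub, map_one, map_mul, map_star]
  have e1 : ∀ j, φ j D * φ j D' = (t : ℂ) • 1 := fun j => by
    rw [← map_mul, hDD, map_smul, map_one]
  have e2 : ∀ j, φ j D * φ j U * φ j D' = (1 : ℂ) • φ j U := fun j => by
    rw [← map_mul, ← map_mul, hDU, one_smul]
  have e3 : ∀ j, φ j D * star (φ j U) * φ j D' = ((t : ℂ) ^ 2) • star (φ j U) := fun j => by
    rw [← map_star, ← map_mul, ← map_mul, hDU', map_smul]
  set n : ℕ → B := fun j => ρ⁻¹ • (φ j D * (E * k * h * φ j D' - φ j D' * (E * k * h)))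
    + ((φ j D * E * φ j U * (w * h * φ j D' - φ j D' * (w * h))
      + (φ j D * E - E * φ j D) * (φ j U * φ j D' * (w * h)))
      + (E * φ j U - φ j U * E) * (w * h))
    + (φ j D * (E * star w) * star (φ j U) * (h * φ j D' - φ j D' * h)
      + (φ j D * (E * star w) - E * star w * φ j D) * (star (φ j U) * φ j D' * h)) with hn
  have hn0 : Tendsto n atTop (𝓝 0) := by
    have h1 := (bounded_mul_tendsto_zero bD (hcomm' D' (E * k * h))).const_smul ρ⁻¹
    have h2 := bounded_mul_tendsto_zero (mul_bound (mul_bound bD (bc E)) bU) (hcomm' D' (w * h))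
    have h3 := tendsto_zero_mul_of_bounded (hcomm D E) (mul_bound (mul_bound bU bD') (bc (w * h)))
    have h4 := tendsto_zero_mul_of_bounded (hcomm' U E) (bc (w * h))
    have h5 := bounded_mul_tendsto_zero (mul_bound (mul_bound bD (bc (E * star w))) bU')
      (hcomm' D' h)
    have h6 := tendsto_zero_mul_of_bounded (hcomm D (E * star w))
      (mul_bound (mul_bound bU' bD') (bc h))
    simpa using (h1.add ((h2.add h3).add h4)).add (h5.add h6)
  obtain ⟨j, hj⟩ := (hn0.norm.eventually (gt_mem_nhds
    (show ‖(0 : B)‖ < θ / 2 by simpa using hθ))).exists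
  refine ⟨φ j U, φ j e, ρ⁻¹ • φ j D, φ j D', hu j, fun τ hτ => ?_, ?_⟩
  · have hW' : ∀ i, (τ (φ j (W i * star (W i)))).re = (τ (star (φ j e) * φ j e)).re := fun i => by
      rw [map_mul, hτ.isPositiveTrace.map_mul_comm, ← map_mul, hW, map_mul, map_star]
    have h1 : (τ (φ j (star q * q + ∑ i, W i * star (W i)))).re = 1 := by
      rw [hq, map_one, hτ.map_one, Complex.one_re]
    rw [map_add, hτ.isPositiveTrace.map_add, Complex.add_re, map_sum, hτ.isPositiveTrace.re_sum,
      Finset.sum_congr rfl fun i _ => hW' i, map_mul, map_star] at h1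
    have h2 := (hτ.isPositiveTrace.nonneg _ (star_mul_self_nonneg (φ j q))).1
    simp only [Finset.sum_const, Finset.card_univ, Fintype.card_fin, nsmul_eq_mul] at h1
    push_cast at h1
    rw [le_div_iff₀ (by positivity)]
    linarith
  · have key : ρ⁻¹ • φ j D * (E * (k + ρ • (φ j U * w + star (φ j U * w))) * h) * φ j D'
        - φ j U * (E * w * h)
        = n j + (ρ⁻¹ • (t : ℂ) • (E * k * h) + (t : ℂ) ^ 2 • (E * star w * star (φ j U) * h)) := by
      have s1 : ρ⁻¹ • φ j D * (E * (k + ρ • (φ j U * w + star (φ j U * w))) * h) * φ j D'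
          = ρ⁻¹ • (φ j D * (E * k * h) * φ j D') + φ j D * (E * φ j U * (w * h)) * φ j D'
            + φ j D * (E * star w * star (φ j U) * h) * φ j D' := by
        simp only [mul_add, add_mul, smul_add, smul_mul_assoc, mul_smul_comm, star_mul, smul_smul,
          mul_inv_cancel₀ hρ.ne', one_smul, mul_assoc, add_assoc]
      rw [s1, conj_eq_add_commutator (e1 j), conj_mul_mul_eq_add_commutator (e2 j),
        conj_mul_mul_eq_add_commutator (e3 j), hn]
      simp only [one_smul, smul_add, mul_assoc, mul_sub, sub_mul]
      abel
    have b1 : ‖ρ⁻¹ • (t : ℂ) • (E * k * h)‖ ≤ t * (ρ⁻¹ * ‖E * k * h‖) := by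
      rw [norm_smul, norm_smul, Complex.norm_real, Real.norm_of_nonneg ht0.le,
        Real.norm_of_nonneg (by positivity)]
      exact (mul_left_comm _ _ _).le
    have b2 : ‖(t : ℂ) ^ 2 • (E * star w * star (φ j U) * h)‖ ≤ t * (‖E * star w‖ * ‖h‖) := by
      rw [norm_smul, norm_pow, Complex.norm_real, Real.norm_of_nonneg ht0.le]
      have hu1 : ‖star (φ j U)‖ ≤ 1 :=
        (norm_star _).trans_le (norm_le_one_of_star_mul_self (hu j))
      have := norm_mul_le_of_norm_le
        (norm_mul_le_of_norm_le (le_refl ‖E * star w‖) hu1) (le_refl ‖h‖)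
      rw [mul_one] at this
      have ht1 : t ^ 2 ≤ t := by nlinarith [min_le_left 1 (θ / (2 * (K + 1)))]
      gcongr
    rw [key]
    have b3 := norm_add_le (n j)
      (ρ⁻¹ • (t : ℂ) • (E * k * h) + (t : ℂ) ^ 2 • (E * star w * star (φ j U) * h))
    have b4 := norm_add_le (ρ⁻¹ • (t : ℂ) • (E * k * h))
      ((t : ℂ) ^ 2 • (E * star w * star (φ j U) * h))
    rw [hK, mul_add] at htK
    linarith

lemma dense_setOf_exists_conj_near (hAD : ApproxDivisible B) (hSC : StrictComparison B) {a g : B}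
    (ha : 0 ≤ a) (ha1 : a ≤ 1) (hg : 0 ≤ g) (hg1 : g ≤ 1) (hgap : HasTraceGaps a)
    (hdom : TraceDominated a g) {ε : ℝ} (hε : 0 < ε) :
    Dense {x : B | ∃ v : B, ‖v * (CFC.sqrt a * (x + star x) * g * (x + star x) * CFC.sqrt a)
      * star v - a‖ < ε} := by
  rw [Metric.dense_iff]
  intro x₀ r₀ hr₀
  obtain ⟨δ, γ, hδ, hγ, hγ'⟩ := hgap (ε / 2 / 2) (by positivity)
  obtain ⟨w, hw⟩ := exists_norm_sqrt_mul_sub_ramp_le ha hg hδ (by positivity : 0 < γ / 3 / 2)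
    (cuntzLE_ramp hSC ha hg hg1 hgap hdom hδ)
  set y := CFC.sqrt a * w * CFC.sqrt g with hy
  set r := cfc (ramp δ) a with hr
  obtain ⟨m, hm⟩ := exists_nat_one_div_lt (by positivity : 0 < γ / 3)
  set θ : ℝ := min 1 (γ / 3 / 2 / (2 * ‖y‖ + 1)) with hθ
  have hθ0 : 0 < θ := lt_min one_pos (by positivity)
  have hθ1 : θ * (2 * ‖y‖ + 1) ≤ γ / 3 / 2 :=
    (le_div_iff₀ (by positivity)).1 (min_le_right _ _)
  set ρ : ℝ := r₀ / (2 * (‖w‖ + 1)) with hρ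
  have hρ0 : 0 < ρ := by positivity
  have hρ1 : ρ * ‖w‖ < r₀ := by
    have : ρ * (2 * (‖w‖ + 1)) = r₀ := div_mul_cancel₀ _ (by positivity)
    nlinarith [norm_nonneg w]
  obtain ⟨u, e, d, d', hue, he, hz⟩ :=
    exists_perturbation hAD (CFC.sqrt a) (CFC.sqrt g) (x₀ + star x₀) w m hρ0 hθ0
  have hun := norm_le_one_of_star_mul_self hue
  refine ⟨x₀ + ρ • (u * w), ?_, ?_⟩
  · rw [mem_ball_iff_norm, add_sub_cancel_left, norm_smul, Real.norm_of_nonneg hρ0.le]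
    refine lt_of_le_of_lt ?_ hρ1
    have := norm_mul_le_of_norm_le hun (le_refl ‖w‖)
    rw [one_mul] at this
    gcongr
  have hk : x₀ + ρ • (u * w) + star (x₀ + ρ • (u * w))
      = x₀ + star x₀ + ρ • (u * w + star (u * w)) := by
    simp only [star_add, star_smul, star_trivial, smul_add]
    abel
  have hks : star (x₀ + ρ • (u * w) + star (x₀ + ρ • (u * w)))
      = x₀ + ρ • (u * w) + star (x₀ + ρ • (u * w)) := by
    rw [star_add, star_star, add_comm]
  rw [Set.mem_ofPred_eq]
  rw [← hk] at hz
  set k := x₀ + ρ • (u * w) + star (x₀ + ρ • (u * w)) with hkdef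
  set z := d * (CFC.sqrt a * k * CFC.sqrt g) * d' with hzdef
  have hr0 : 0 ≤ r := cfc_ramp_nonneg _ _
  have h1 : CuntzLE (cfc (cutoff (ε / 2)) a) (cfc (cutoff (γ / 3)) (u * r * star u)) :=
    cuntzLE_cutoff_shift hSC ha ha1 (half_pos hε) (by positivity)
      (by linarith : 1 / ((m : ℝ) + 1) + γ / 3 < γ) hγ' hue he
  have h2 : ‖z * star z - u * r * star u‖ ≤ γ / 3 := by
    have hyn : ‖u * y‖ ≤ ‖y‖ := by
      simpa using norm_mul_le_of_norm_le hun (le_refl ‖y‖)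
    have hq : ‖u * y * star (u * y) - u * r * star u‖ ≤ γ / 3 / 2 := by
      have e1 : u * y * star (u * y) - u * r * star u = u * (y * star y - r) * star u := by
        rw [star_mul]; noncomm_ring
      rw [e1]
      have := norm_mul_le_of_norm_le (norm_mul_le_of_norm_le hun hw)
        ((norm_star u).trans_le hun)
      linarith
    have := norm_mul_star_sub_le hz (min_le_left _ _) hq
    have h3 : θ * (2 * ‖u * y‖ + 1) ≤ θ * (2 * ‖y‖ + 1) := by gcongr
    linarith
  have h3 : CuntzLE (cfc (cutoff (γ / 3)) (u * r * star u)) (z * star z) :=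
    cuntzLE_cutoff_of_norm_sub_le (star_right_conjugate_nonneg hr0 u) (mul_star_self_nonneg z)
      ((norm_sub_rev _ _).trans_le h2)
  have h4 : CuntzLE (z * star z) (CFC.sqrt a * k * g * k * CFC.sqrt a) := by
    set x := d * (CFC.sqrt a * k * CFC.sqrt g) with hx
    have e1 : z * star z = x * (d' * star d') * star x := by
      rw [hzdef, star_mul]; simp only [mul_assoc]
    have e2 : x * star x = d * (CFC.sqrt a * k * g * k * CFC.sqrt a) * star d := by
      have hg2 := CFC.sqrt_mul_sqrt_self g hg
      have hgs : star (CFC.sqrt g) = CFC.sqrt g := (CFC.sqrt_nonneg g).isSelfAdjoint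
      have has : star (CFC.sqrt a) = CFC.sqrt a := (CFC.sqrt_nonneg a).isSelfAdjoint
      rw [hx, star_mul, star_mul, star_mul, hks, hgs, has]
      conv_rhs => rw [← hg2]
      simp only [mul_assoc]
    have h5 : z * star z ≤ ‖d' * star d'‖ • (x * star x) := by
      have h6 := (mul_star_self_nonneg d').isSelfAdjoint.le_algebraMap_norm_self
      have h7 := star_right_conjugate_le_conjugate h6 x
      rw [← e1, Algebra.algebraMap_eq_smul_one] at h7
      simpa using h7
    refine cuntzLE_trans (cuntzLE_of_le (mul_star_self_nonneg z) h5)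
      (cuntzLE_trans (cuntzLE_smul (norm_nonneg _) _) ?_)
    rw [e2]
    exact cuntzLE_conj _ _
  obtain ⟨v, hv⟩ := cuntzLE_iff_forall_exists_norm_lt.1
    (cuntzLE_trans h1 (cuntzLE_trans h3 h4)) (ε / 2) (half_pos hε)
  refine ⟨v, ?_⟩
  have h8 := norm_cutoff_sub_le ha (half_pos hε).le
  have h9 := norm_sub_le_norm_sub_add_norm_sub
    (v * (CFC.sqrt a * k * g * k * CFC.sqrt a) * star v) (cfc (cutoff (ε / 2)) a) a
  linarith

/-- Under a uniform trace comparison, `a` lies below a compression of a suitable conjugate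
`k g k` of `g` by its own square root. -/
theorem exists_isSelfAdjoint_cuntzLE_conj (hAD : ApproxDivisible B) (hSC : StrictComparison B)
    {a g : B} (ha : 0 ≤ a) (ha1 : a ≤ 1) (hg : 0 ≤ g) (hg1 : g ≤ 1) (hgap : HasTraceGaps a)
    (hdom : TraceDominated a g) :
    ∃ k : B, IsSelfAdjoint k ∧ CuntzLE a (CFC.sqrt a * k * g * k * CFC.sqrt a) := by
  have h := dense_iInter_of_isOpen (X := B) (f := fun n : ℕ => {x : B | ∃ v : B,
      ‖v * (CFC.sqrt a * (x + star x) * g * (x + star x) * CFC.sqrt a) * star v - a‖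
        < 1 / ((n : ℝ) + 1)}) (fun n => ?_)
    fun n => dense_setOf_exists_conj_near hAD hSC ha ha1 hg hg1 hgap hdom Nat.one_div_pos_of_nat
  · obtain ⟨x, hx⟩ := h.nonempty
    rw [Set.mem_iInter] at hx
    refine ⟨x + star x, IsSelfAdjoint.add_star_self x,
      cuntzLE_iff_forall_exists_norm_lt.2 fun ε hε => ?_⟩
    obtain ⟨n, hn⟩ := exists_nat_one_div_lt hε
    obtain ⟨v, hv⟩ := hx n
    exact ⟨v, hv.trans hn⟩
  · simp only [Set.ofPred_exists]
    exact isOpen_iUnion fun v => isOpen_lt (by fun_prop) continuous_const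

end Perturbation

section TraceBounds

variable {A : Type*} [CStarAlgebra A] [PartialOrder A] [StarOrderedRing A]

lemma IsPositiveTrace.re_star_mul_self_nonneg {τ : A → ℂ} (hτ : IsPositiveTrace τ) (x : A) :
    0 ≤ (τ (star x * x)).re := (hτ.nonneg _ (star_mul_self_nonneg x)).1

lemma IsPositiveTrace.re_star_add_mul_add_le {τ : A → ℂ} (hτ : IsPositiveTrace τ) (x y : A) :
    (τ (star (x + y) * (x + y))).re
      ≤ 2 * (τ (star x * x)).re + 2 * (τ (star y * y)).re := by
  have h : star (x + y) * (x + y) + star (x - y) * (x - y)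
      = (2 : ℝ) • (star x * x) + (2 : ℝ) • (star y * y) := by
    rw [star_add, star_sub, two_smul, two_smul]; noncomm_ring
  have h1 := congrArg (fun z => (τ z).re) h
  simp only [hτ.map_add, Complex.add_re, hτ.re_smul] at h1
  linarith [hτ.re_star_mul_self_nonneg (x - y)]

lemma star_mul_self_le_norm_smul (b z : A) :
    star (b * z) * (b * z) ≤ ‖star b * b‖ • (star z * z) := by
  have h : star b * b ≤ algebraMap ℝ A ‖star b * b‖ :=
    (IsSelfAdjoint.star_mul_self b).le_algebraMap_norm_self
  calc star (b * z) * (b * z) = star z * (star b * b) * z := by rw [star_mul]; noncomm_ring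
    _ ≤ star z * algebraMap ℝ A ‖star b * b‖ * z := star_left_conjugate_le_conjugate h z
    _ = ‖star b * b‖ • (star z * z) := by
      rw [Algebra.algebraMap_eq_smul_one, mul_smul_comm, smul_mul_assoc, mul_one]

lemma IsPositiveTrace.re_star_mul_mul_le_left {τ : A → ℂ} (hτ : IsPositiveTrace τ) (b z : A) :
    (τ (star (b * z) * (b * z))).re ≤ ‖star b * b‖ * (τ (star z * z)).re :=
  (hτ.re_mono (star_mul_self_le_norm_smul b z)).trans_eq (hτ.re_smul _ _)

lemma IsPositiveTrace.re_star_mul_mul_le_right {τ : A → ℂ} (hτ : IsPositiveTrace τ) (b z : A) :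
    (τ (star (z * b) * (z * b))).re ≤ ‖b * star b‖ * (τ (star z * z)).re := by
  have h := hτ.re_star_mul_mul_le_left (star b) (star z)
  rw [← star_mul] at h
  simp only [star_star] at h
  rwa [hτ.map_mul_comm (z * b), hτ.map_mul_comm z] at h

/-- The closed two-sided ideal of elements whose trace seminorms are controlled by `τ c`. -/
def traceControlIdeal (c : A) : TwoSidedIdeal A :=
  TwoSidedIdeal.mk' {z | ∀ ε > (0 : ℝ), ∃ C ≥ (0 : ℝ), ∀ τ : A → ℂ, IsTracialState τ →
      (τ (star z * z)).re ≤ C * (τ c).re + ε}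
    (fun ε hε => ⟨0, le_rfl, fun τ hτ => by simp [hτ.isPositiveTrace.map_zero, hε.le]⟩)
    (fun {x y} hx hy ε hε => by
      obtain ⟨C, hC, h⟩ := hx (ε / 4) (by positivity)
      obtain ⟨D, hD, h'⟩ := hy (ε / 4) (by positivity)
      refine ⟨2 * C + 2 * D, by positivity, fun τ hτ => ?_⟩
      have := hτ.isPositiveTrace.re_star_add_mul_add_le x y
      linarith [h τ hτ, h' τ hτ])
    (fun {x} hx ε hε => by simpa using hx ε hε)
    (fun {b z} hz ε hε => by
      obtain ⟨C, hC, h⟩ := hz (ε / (‖star b * b‖ + 1)) (by positivity)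
      refine ⟨‖star b * b‖ * C, by positivity, fun τ hτ => ?_⟩
      have h1 := hτ.isPositiveTrace.re_star_mul_mul_le_left b z
      have h2 := mul_le_mul_of_nonneg_left (h τ hτ) (norm_nonneg (star b * b))
      have h3 : ‖star b * b‖ * (ε / (‖star b * b‖ + 1)) ≤ ε := by
        rw [mul_div_assoc', div_le_iff₀ (by positivity)]; nlinarith
      nlinarith)
    (fun {z b} hz ε hε => by
      obtain ⟨C, hC, h⟩ := hz (ε / (‖b * star b‖ + 1)) (by positivity)
      refine ⟨‖b * star b‖ * C, by positivity, fun τ hτ => ?_⟩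
      have h1 := hτ.isPositiveTrace.re_star_mul_mul_le_right b z
      have h2 := mul_le_mul_of_nonneg_left (h τ hτ) (norm_nonneg (b * star b))
      have h3 : ‖b * star b‖ * (ε / (‖b * star b‖ + 1)) ≤ ε := by
        rw [mul_div_assoc', div_le_iff₀ (by positivity)]; nlinarith
      nlinarith)

lemma mem_traceControlIdeal {c z : A} : z ∈ traceControlIdeal c ↔
    ∀ ε > (0 : ℝ), ∃ C ≥ (0 : ℝ), ∀ τ : A → ℂ, IsTracialState τ →
      (τ (star z * z)).re ≤ C * (τ c).re + ε :=
  TwoSidedIdeal.mem_mk' ..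

lemma isClosed_traceControlIdeal (c : A) : IsClosed (traceControlIdeal c : Set A) := by
  refine isClosed_of_closure_subset fun z hz => mem_traceControlIdeal.2 fun ε hε => ?_
  obtain ⟨y, hy, hyz⟩ := Metric.mem_closure_iff.1 hz (√(ε / 4)) (by positivity)
  obtain ⟨C, hC, h⟩ := mem_traceControlIdeal.1 hy (ε / 4) (by positivity)
  refine ⟨2 * C, by positivity, fun τ hτ => ?_⟩
  have h1 := hτ.isPositiveTrace.re_star_add_mul_add_le y (z - y)
  have h2 : (τ (star (z - y) * (z - y))).re ≤ ε / 4 := by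
    have h3 := hτ.isPositiveTrace.re_le_of_norm_le (IsSelfAdjoint.star_mul_self (z - y)) le_rfl
    rw [hτ.map_one, Complex.one_re, mul_one, CStarRing.norm_star_mul_self, ← sq] at h3
    rw [dist_eq_norm] at hyz
    have h4 : ‖z - y‖ ^ 2 ≤ √(ε / 4) ^ 2 := pow_le_pow_left₀ (norm_nonneg _) hyz.le 2
    rw [Real.sq_sqrt (by positivity)] at h4
    linarith
  rw [add_sub_cancel] at h1
  linarith [h τ hτ]

/-- In a simple C*-algebra, tracial states are uniformly bounded below on a nonzero positive
element. -/
theorem exists_trace_lower_bound (hA : CStarSimple A) {c : A} (hc : 0 ≤ c) (hc0 : c ≠ 0) :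
    ∃ γ : ℝ, 0 < γ ∧ ∀ τ : A → ℂ, IsTracialState τ → γ ≤ (τ c).re := by
  have hmem : c ∈ traceControlIdeal c := mem_traceControlIdeal.2 fun ε hε => by
    refine ⟨‖c‖, norm_nonneg c, fun τ hτ => ?_⟩
    have h : star c * c ≤ ‖c‖ • c := by
      have hs := CFC.sqrt_mul_sqrt_self c hc
      have hsa := (CFC.sqrt_nonneg c).isSelfAdjoint.star_eq
      have h1 := star_left_conjugate_le_conjugate hc.isSelfAdjoint.le_algebraMap_norm_self
        (CFC.sqrt c)
      rw [hsa, Algebra.algebraMap_eq_smul_one, mul_smul_comm, smul_mul_assoc, mul_one, hs] at h1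
      refine le_trans (le_of_eq ?_) h1
      rw [hc.isSelfAdjoint.star_eq]
      calc c * c = CFC.sqrt c * CFC.sqrt c * (CFC.sqrt c * CFC.sqrt c) := by rw [hs]
        _ = CFC.sqrt c * (CFC.sqrt c * CFC.sqrt c) * CFC.sqrt c := by noncomm_ring
        _ = CFC.sqrt c * c * CFC.sqrt c := by rw [hs]
    have := hτ.isPositiveTrace.re_mono h
    rw [hτ.isPositiveTrace.re_smul] at this
    linarith
  have htop : traceControlIdeal c = ⊤ := by
    refine (hA _ (isClosed_traceControlIdeal c)).resolve_left fun h => hc0 ?_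
    rw [h] at hmem
    simpa using hmem
  obtain ⟨C, hC, h⟩ := mem_traceControlIdeal.1 (show (1 : A) ∈ traceControlIdeal c by
    rw [htop]; trivial) (1 / 2) (by norm_num)
  refine ⟨1 / (2 * (C + 1)), by positivity, fun τ hτ => ?_⟩
  have h1 := h τ hτ
  have h2 := (hτ.isPositiveTrace.nonneg c hc).1
  rw [star_one, mul_one, hτ.map_one, Complex.one_re] at h1
  rw [div_le_iff₀ (by positivity)]
  nlinarith

lemma ramp_mono_left {δ ε : ℝ} (hδ : 0 < δ) (h : δ ≤ ε) (t : ℝ) : ramp ε t ≤ ramp δ t := by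
  rcases le_or_gt t ε with ht | ht
  · rw [ramp_of_le (hδ.trans_le h) ht]; exact ramp_nonneg _ _
  · unfold ramp
    refine max_le_max le_rfl (min_le_min le_rfl ?_)
    rw [div_le_div_iff₀ (hδ.trans_le h) hδ]
    nlinarith

lemma hasTraceGaps_of_spectrum (hA : CStarSimple A) {a : A} (ha : IsSelfAdjoint a)
    (h : ∀ ε > (0 : ℝ), ∃ t ∈ spectrum ℝ a, 0 < t ∧ t < ε) : HasTraceGaps a := by
  intro ε hε
  obtain ⟨t, ht, ht0, htε⟩ := h ε hε
  have hδ : 0 < t / 2 := by positivity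
  have hcont : Continuous fun u => ramp (t / 2) u - ramp ε u :=
    (continuous_ramp _).sub (continuous_ramp _)
  have hle : 0 ≤ cfc (fun u => ramp (t / 2) u - ramp ε u) a :=
    cfc_nonneg fun u _ => sub_nonneg.2 (ramp_mono_left hδ (by linarith) u)
  have hne : cfc (fun u => ramp (t / 2) u - ramp ε u) a ≠ 0 := by
    intro h0
    have h1 : ramp (t / 2) t - ramp ε t ∈ spectrum ℝ (cfc (fun u => ramp (t / 2) u - ramp ε u) a) := by
      rw [cfc_map_spectrum _ a ha hcont.continuousOn]
      exact ⟨t, ht, rfl⟩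
    rw [h0, ramp_of_ge hδ (by linarith), ramp_of_le hε htε.le] at h1
    by_cases hn : Nontrivial A
    · rw [spectrum.zero_eq] at h1; simp at h1
    · rw [not_nontrivial_iff_subsingleton] at hn
      simp [spectrum.of_subsingleton] at h1
  obtain ⟨γ, hγ, hτγ⟩ := exists_trace_lower_bound hA hle hne
  refine ⟨t / 2, γ, hδ, hγ, fun τ hτ => ?_⟩
  have := hτγ τ hτ
  rw [cfc_sub (fun u => ramp (t / 2) u) (fun u => ramp ε u) a
    (continuous_ramp _).continuousOn (continuous_ramp _).continuousOn,
    hτ.isPositiveTrace.map_sub, Complex.sub_re] at this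
  linarith

end TraceBounds

section RegularizeTrace

variable {A B : Type*} [CStarAlgebra A] [PartialOrder A] [StarOrderedRing A]
  [CStarAlgebra B] [PartialOrder B] [StarOrderedRing B]

lemma map_resolventAt (φ : A →⋆ₐ[ℂ] B) {a : A} (ha : 0 ≤ a) {s : ℝ} (hs : 0 < s) :
    φ (resolventAt s a) = resolventAt s (φ a) := by
  have h := congrArg φ (resolventAt_mul ha hs)
  rw [map_mul, map_add, map_one, ← Complex.coe_smul, map_smul, map_one, Complex.coe_smul] at h
  exact left_inv_eq_right_inv h (mul_resolventAt (map_nonneg φ ha) hs)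

lemma map_regularize (φ : A →⋆ₐ[ℂ] B) {a : A} (ha : 0 ≤ a) {s : ℝ} (hs : 0 < s) :
    φ (regularize s a) = regularize s (φ a) := by
  rw [regularize, map_sub, map_one, ← Complex.coe_smul, map_smul, map_resolventAt φ ha hs,
    Complex.coe_smul, regularize]

lemma norm_resolventAt_le {a : A} (ha : 0 ≤ a) {s : ℝ} (hs : 0 < s) :
    ‖resolventAt s a‖ ≤ s⁻¹ := by
  refine norm_cfc_le (by positivity) fun t ht => ?_
  have h0 := spectrum_nonneg_of_nonneg ha ht
  rw [Real.norm_of_nonneg (by positivity)]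
  exact inv_anti₀ hs (by linarith)

lemma resolventAt_sub_resolventAt {a b : A} (ha : 0 ≤ a) (hb : 0 ≤ b) {s : ℝ} (hs : 0 < s) :
    resolventAt s a - resolventAt s b = resolventAt s a * (b - a) * resolventAt s b := by
  calc resolventAt s a - resolventAt s b
      = resolventAt s a * ((b + s • 1) * resolventAt s b)
        - (resolventAt s a * (a + s • 1)) * resolventAt s b := by
        rw [resolventAt_mul ha hs, mul_resolventAt hb hs, mul_one, one_mul]
    _ = _ := by noncomm_ring

lemma norm_regularize_sub_le {a b : A} (ha : 0 ≤ a) (hb : 0 ≤ b) {s κ : ℝ} (hs : 0 < s)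
    (hab : ‖b - a‖ ≤ κ * s) : ‖regularize s a - regularize s b‖ ≤ κ := by
  have h : regularize s a - regularize s b
      = -(s • (resolventAt s a * (b - a) * resolventAt s b)) := by
    rw [← resolventAt_sub_resolventAt ha hb hs, regularize, regularize, smul_sub]; abel
  rw [h, norm_neg, norm_smul, Real.norm_of_nonneg hs.le]
  have h1 := norm_mul_le_of_norm_le
    (norm_mul_le_of_norm_le (norm_resolventAt_le ha hs) hab) (norm_resolventAt_le hb hs)
  calc s * _ ≤ s * (s⁻¹ * (κ * s) * s⁻¹) := by gcongr
    _ = κ := by field_simp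

lemma resolventAt_antitone {a b : A} (ha : 0 ≤ a) (hab : a ≤ b) {s : ℝ} (hs : 0 < s) :
    resolventAt s b ≤ resolventAt s a := by
  have key : ∀ {c : A}, 0 ≤ c → Ring.inverse (c + s • 1) = resolventAt s c := fun {c} hc => by
    have hu : IsUnit (c + s • 1) :=
      isUnit_iff_exists.2 ⟨_, mul_resolventAt hc hs, resolventAt_mul hc hs⟩
    exact left_inv_eq_right_inv (Ring.inverse_mul_cancel _ hu) (mul_resolventAt hc hs)
  rw [← key ha, ← key (ha.trans hab)]
  refine CStarAlgebra.ringInverse_le_ringInverse (by gcongr) ?_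
  refine ⟨add_nonneg ha (smul_nonneg hs.le zero_le_one), ?_⟩
  exact isUnit_iff_exists.2 ⟨_, mul_resolventAt ha hs, resolventAt_mul ha hs⟩

lemma regularize_mono {a b : A} (ha : 0 ≤ a) (hab : a ≤ b) {s : ℝ} (hs : 0 < s) :
    regularize s a ≤ regularize s b := by
  unfold regularize
  have := smul_le_smul_of_nonneg_left (resolventAt_antitone ha hab hs) hs.le
  exact sub_le_sub_left this 1

lemma regularize_smul {a : A} (ha : 0 ≤ a) {s R : ℝ} (hs : 0 < s) (hR : 0 < R) :
    regularize s (R • a) = regularize (s / R) a := by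
  have h1 := resolventAt_mul (smul_nonneg hR.le ha) hs
  have h2 := mul_resolventAt ha (div_pos hs hR)
  have h3 : R • a + s • (1 : A) = R • (a + (s / R) • 1) := by
    rw [smul_add, smul_smul, mul_div_cancel₀ _ hR.ne']
  rw [h3, mul_smul_comm, ← smul_mul_assoc] at h1
  have h4 := left_inv_eq_right_inv h1 h2
  rw [regularize, regularize, ← h4, smul_smul, div_mul_cancel₀ _ hR.ne']

lemma IsPositiveTrace.regularize_mul_star {τ : A → ℂ} (hτ : IsPositiveTrace τ) (y : A) {s : ℝ}
    (hs : 0 < s) : τ (regularize s (y * star y)) = τ (regularize s (star y * y)) := by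
  set P := y * star y with hP
  set Q := star y * y with hQ
  have hP0 : 0 ≤ P := mul_star_self_nonneg y
  have hQ0 : 0 ≤ Q := star_mul_self_nonneg y
  have hreg : ∀ {c : A}, 0 ≤ c → regularize s c = c * resolventAt s c := fun {c} hc => by
    have h := mul_resolventAt hc hs
    rw [add_mul, smul_mul_assoc, one_mul] at h
    rw [regularize, ← h, add_sub_cancel_right]
  have hint : resolventAt s P * y = y * resolventAt s Q := by
    have h : y * (Q + s • 1) = (P + s • 1) * y := by
      rw [mul_add, add_mul, hP, hQ, mul_smul_comm, smul_mul_assoc, mul_one, one_mul, mul_assoc]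
    calc resolventAt s P * y = resolventAt s P * (y * (Q + s • 1)) * resolventAt s Q := by
          rw [mul_assoc, mul_assoc, mul_resolventAt hQ0 hs, mul_one]
      _ = (resolventAt s P * (P + s • 1)) * y * resolventAt s Q := by rw [h]; noncomm_ring
      _ = _ := by rw [resolventAt_mul hP0 hs, one_mul]
  rw [hreg hP0, hreg hQ0, hP, mul_assoc, hτ.map_mul_comm, ← hP, mul_assoc, hint, ← mul_assoc]

/-- A quantitative form of the statement that Cuntz subequivalence increases traces. -/
lemma IsPositiveTrace.re_regularize_le {τ : A → ℂ} (hτ : IsPositiveTrace τ) {a g r : A}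
    (ha : 0 ≤ a) (hg : 0 ≤ g) {s κ R : ℝ} (hs : 0 < s) (hr : ‖r * g * star r - a‖ ≤ κ * s)
    (hR : 0 < R) (hrR : ‖star r * r‖ ≤ R) :
    (τ (regularize s a)).re ≤ (τ (regularize (s / R) g)).re + κ * (τ 1).re := by
  have hsq := CFC.sqrt_mul_sqrt_self g hg
  have hsa := (CFC.sqrt_nonneg g).isSelfAdjoint.star_eq
  have h1 : (r * CFC.sqrt g) * star (r * CFC.sqrt g) = r * g * star r := by
    rw [star_mul, hsa, mul_assoc, ← mul_assoc (CFC.sqrt g), hsq, mul_assoc]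
  have h2 : star (r * CFC.sqrt g) * (r * CFC.sqrt g) ≤ R • g := by
    have h := star_left_conjugate_le_conjugate
      ((IsSelfAdjoint.star_mul_self r).le_algebraMap_norm_self.trans
        (algebraMap_mono A hrR)) (CFC.sqrt g)
    rw [hsa, Algebra.algebraMap_eq_smul_one R, mul_smul_comm, smul_mul_assoc, mul_one, hsq] at h
    refine le_trans (le_of_eq ?_) h
    rw [star_mul, hsa]; noncomm_ring
  have h3 := hτ.re_le_add_of_norm_sub_le (isSelfAdjoint_regularize s a)
    (isSelfAdjoint_regularize s _)
    (norm_regularize_sub_le ha (mul_star_self_nonneg (r * CFC.sqrt g)) hs (by rwa [h1]))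
  rw [hτ.regularize_mul_star _ hs] at h3
  have h4 := hτ.re_mono (regularize_mono (star_mul_self_nonneg _) h2 hs)
  rw [regularize_smul hg hs hR] at h4
  linarith

lemma IsPositiveTrace.comp {τ : B → ℂ} (hτ : IsPositiveTrace τ) (φ : A →⋆ₐ[ℂ] B) :
    IsPositiveTrace (fun x => τ (φ x)) where
  map_add x y := by simp only [_root_.map_add, hτ.map_add]
  map_smul c x := by simp only [_root_.map_smul, hτ.map_smul]
  nonneg x hx := hτ.nonneg _ (map_nonneg φ hx)
  map_mul_comm x y := by simp only [map_mul, hτ.map_mul_comm (φ x)]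

lemma IsTracialState.comp {τ : B → ℂ} (hτ : IsTracialState τ) (φ : A →⋆ₐ[ℂ] B) :
    IsTracialState (fun x => τ (φ x)) :=
  have h := hτ.isPositiveTrace.comp φ
  ⟨h.map_add, h.map_smul, by simp only [_root_.map_one, hτ.map_one], h.nonneg, h.map_mul_comm⟩

lemma HasTraceGaps.map {a : A} (h : HasTraceGaps a) (ha : IsSelfAdjoint a) (φ : A →⋆ₐ[ℂ] B) :
    HasTraceGaps (φ a) := by
  intro ε hε
  obtain ⟨δ, γ, hδ, hγ, H⟩ := h ε hε
  have key : ∀ η : ℝ, φ (cfc (ramp η) a) = cfc (ramp η) (φ a) := fun η =>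
    StarAlgHomClass.map_cfc φ (ramp η) a (continuous_ramp η).continuousOn
      (map_continuous φ) ha (ha.map φ)
  refine ⟨δ, γ, hδ, hγ, fun τ hτ => ?_⟩
  rw [← key, ← key]
  exact H _ (hτ.comp φ)

end RegularizeTrace

section ContinuousFunctions

instance {X A : Type*} [TopologicalSpace X] [CompactSpace X] [CStarAlgebra A] [PartialOrder A]
    [StarOrderedRing A] : StarOrderedRing C(X, A) :=
  .of_nonneg_iff' (fun h z x => add_le_add_right (h x) (z x)) fun f => by
    refine ⟨fun hf => ?_, ?_⟩
    · refine ⟨⟨fun x => CFC.sqrt (f x),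
        CFC.continuousOn_sqrt.comp_continuous f.continuous fun x => hf x⟩, ?_⟩
      ext x
      change f x = star (CFC.sqrt (f x)) * CFC.sqrt (f x)
      rw [(CFC.sqrt_nonneg (f x)).isSelfAdjoint.star_eq, CFC.sqrt_mul_sqrt_self (f x) (hf x)]
    · rintro ⟨s, rfl⟩ x
      exact star_mul_self_nonneg (s x)

/-- The embedding of `A` into `C(X, A)` as constant functions. -/
def constHom (X A : Type*) [TopologicalSpace X] [CompactSpace X] [CStarAlgebra A] :
    A →⋆ₐ[ℂ] C(X, A) where
  toFun := ContinuousMap.const X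
  map_one' := rfl
  map_mul' _ _ := rfl
  map_zero' := rfl
  map_add' _ _ := rfl
  commutes' _ := rfl
  map_star' _ := rfl

/-- Evaluation at a point, as a homomorphism of C*-algebras. -/
def evalHom {X : Type*} (A : Type*) [TopologicalSpace X] [CompactSpace X] [CStarAlgebra A]
    (x : X) : C(X, A) →⋆ₐ[ℂ] A where
  toFun f := f x
  map_one' := rfl
  map_mul' _ _ := rfl
  map_zero' := rfl
  map_add' _ _ := rfl
  commutes' _ := rfl
  map_star' _ := rfl

lemma isOpen_setOf_norm_sub_lt {X E : Type*} [TopologicalSpace X] [SeminormedAddCommGroup E]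
    (f g : C(X, E)) (ε : ℝ) : IsOpen {y | ‖f y - g y‖ < ε} :=
  isOpen_lt (by fun_prop) continuous_const

variable {X : Type*} [MetricSpace X] [CompactSpace X] {A : Type*} [CStarAlgebra A]

lemma exists_finset_cover {U : X → Set X} (hU : ∀ x, IsOpen (U x)) (hx : ∀ x, x ∈ U x) :
    ∃ t : Finset X, ∀ y, ∃ x ∈ t, y ∈ U x := by
  obtain ⟨t, ht⟩ := isCompact_univ.elim_finite_subcover U hU fun x _ => Set.mem_iUnion.2 ⟨x, hx x⟩
  exact ⟨t, fun y => by simpa using ht (Set.mem_univ y)⟩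

variable [PartialOrder A] [StarOrderedRing A]

/-- A tracial functional on `C(X, A)` localised by a scalar function. -/
lemma IsPositiveTrace.localize {τ : C(X, A) → ℂ} (hτ : IsPositiveTrace τ) (ρ : C(X, ℝ)) :
    IsPositiveTrace fun z : A => τ ⟨fun x => ρ x ^ 2 • z, by fun_prop⟩ where
  map_add x y := by
    rw [← hτ.map_add]; congr 1; ext u; exact smul_add _ _ _
  map_smul c x := by
    rw [← hτ.map_smul]; congr 1; ext u; exact smul_comm _ _ _
  nonneg x hx := hτ.nonneg _ fun u => smul_nonneg (sq_nonneg (ρ u)) hx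
  map_mul_comm x y := by
    have key : ∀ v w : A, (⟨fun x => ρ x ^ 2 • (v * w), by fun_prop⟩ : C(X, A))
        = (⟨fun x => ρ x • v, by fun_prop⟩ : C(X, A)) * ⟨fun x => ρ x • w, by fun_prop⟩ := by
      intro v w
      ext u
      change ρ u ^ 2 • (v * w) = (ρ u • v) * (ρ u • w)
      rw [smul_mul_smul_comm, sq]
    rw [key, key, hτ.map_mul_comm]

/-- An element of `C(X, A)` whose values have nonnegative traces has nonnegative traces. -/
lemma IsPositiveTrace.re_nonneg_of_pointwise {τ : C(X, A) → ℂ} (hτ : IsPositiveTrace τ)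
    {h : C(X, A)} (hsa : IsSelfAdjoint h)
    (hpos : ∀ x, ∀ σ : A → ℂ, IsPositiveTrace σ → 0 ≤ (σ (h x)).re) : 0 ≤ (τ h).re := by
  have h1 : 0 ≤ (τ 1).re := (hτ.nonneg 1 zero_le_one).1
  refine le_of_forall_pos_le_add fun ε hε => ?_
  set η := ε / ((τ 1).re + 1) with hη
  have hη0 : 0 < η := by positivity
  obtain ⟨t, ht⟩ := exists_finset_cover (U := fun x => {y | ‖h y - ContinuousMap.const X (h x) y‖ < η})
    (fun x => isOpen_setOf_norm_sub_lt _ _ _) (fun x => by simpa using hη0)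
  obtain ⟨ρ, hρ⟩ := PartitionOfUnity.exists_isSubordinate (s := Set.univ) isClosed_univ
    (fun x : t => {y | ‖h y - ContinuousMap.const X (h x) y‖ < η})
    (fun x => isOpen_setOf_norm_sub_lt _ _ _) fun y _ => by
      obtain ⟨x, hx, hy⟩ := ht y
      exact Set.mem_iUnion.2 ⟨⟨x, hx⟩, hy⟩
  let r : t → C(X, ℝ) := fun i => ⟨fun y => √(ρ i y), by fun_prop⟩
  have hr : ∀ i y, r i y ^ 2 = ρ i y := fun i y => Real.sq_sqrt (ρ.nonneg i y)
  have hsum : ∀ y, ∑ i, r i y ^ 2 = 1 := fun y => by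
    simp only [hr]
    rw [← finsum_eq_sum_of_fintype, ρ.sum_eq_one (Set.mem_univ y)]
  let h' : C(X, A) := ∑ i : t, ⟨fun y => r i y ^ 2 • h i, by fun_prop⟩
  have hev : ∀ y, h' y = ∑ i : t, r i y ^ 2 • h i := fun y => by
    simp [h', ContinuousMap.sum_apply]
  have hsa' : IsSelfAdjoint h' := by
    rw [IsSelfAdjoint]
    ext y
    rw [ContinuousMap.star_apply, hev, star_sum]
    refine Finset.sum_congr rfl fun i _ => ?_
    rw [star_smul, star_trivial, ← ContinuousMap.star_apply, hsa.star_eq]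
  have hnorm : ‖h' - h‖ ≤ η := by
    refine (ContinuousMap.norm_le _ hη0.le).2 fun y => ?_
    have h2 : (h' - h) y = ∑ i : t, r i y ^ 2 • (h i - h y) := by
      rw [ContinuousMap.sub_apply, hev]
      simp only [smul_sub, Finset.sum_sub_distrib]
      rw [← Finset.sum_smul, hsum, one_smul]
    rw [h2]
    calc ‖∑ i : t, r i y ^ 2 • (h i - h y)‖ ≤ ∑ i : t, r i y ^ 2 * η := by
          refine norm_sum_le_of_le _ fun i _ => ?_
          rw [norm_smul, Real.norm_of_nonneg (sq_nonneg _)]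
          by_cases hi : r i y ^ 2 = 0
          · simp [hi]
          · refine mul_le_mul_of_nonneg_left ?_ (sq_nonneg _)
            rw [hr] at hi
            have := hρ i (subset_tsupport _ hi)
            rw [norm_sub_rev]
            exact le_of_lt this
      _ = η := by rw [← Finset.sum_mul, hsum, one_mul]
  have h3 := hτ.re_le_add_of_norm_sub_le hsa' hsa hnorm
  have h4 : 0 ≤ (τ h').re := by
    rw [hτ.re_sum]
    exact Finset.sum_nonneg fun i _ => hpos i _ (hτ.localize (r i))
  have h5 : η * (τ 1).re ≤ ε := by
    rw [hη, div_mul_eq_mul_div, div_le_iff₀ (by positivity)]; nlinarith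
  linarith

lemma traceDominated_const {a : A} (ha : 0 ≤ a) {g : C(X, A)} (hg : 0 ≤ g)
    (hag : ∀ x, CuntzLE a (g x)) : TraceDominated (constHom X A a) g := by
  intro s κ hs hκ
  choose r hr using fun x => cuntzLE_iff_forall_exists_norm_lt.1 (hag x) (κ * s) (by positivity)
  obtain ⟨t, ht⟩ := exists_finset_cover
    (U := fun x => {y | ‖(ContinuousMap.const X (r x) * g * ContinuousMap.const X (star (r x))) y
      - ContinuousMap.const X a y‖ < κ * s})
    (fun x => isOpen_setOf_norm_sub_lt _ _ _) (fun x => hr x)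
  set R := 1 + ∑ x ∈ t, ‖star (r x) * r x‖ with hRdef
  have hsum : 0 ≤ ∑ x ∈ t, ‖star (r x) * r x‖ := Finset.sum_nonneg fun _ _ => norm_nonneg _
  have hR : 0 < R := by positivity
  have hca : 0 ≤ constHom X A a := map_nonneg _ ha
  refine ⟨s / R, by positivity, fun τ hτ => ?_⟩
  have hsa : IsSelfAdjoint (regularize (s / R) g + κ • 1 - regularize s (constHom X A a)) :=
    ((isSelfAdjoint_regularize _ _).add ((IsSelfAdjoint.all κ).smul (.one _))).sub
      (isSelfAdjoint_regularize _ _)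
  have key := hτ.isPositiveTrace.re_nonneg_of_pointwise hsa fun y σ hσ => by
    obtain ⟨x, hx, hy⟩ := ht y
    have h1 : ‖star (r x) * r x‖ ≤ R := by
      have := Finset.single_le_sum (f := fun x => ‖star (r x) * r x‖) (fun _ _ => norm_nonneg _) hx
      exact this.trans (by linarith)
    have hgy : 0 ≤ g y := hg y
    have h2 := hσ.re_regularize_le ha hgy hs (le_of_lt hy) hR h1
    have h3 : (regularize (s / R) g + κ • 1 - regularize s (constHom X A a)) y
        = regularize (s / R) (g y) + κ • 1 - regularize s a := by
      have e1 := map_regularize (evalHom A y) hg (div_pos hs hR)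
      have e2 := map_regularize (evalHom A y) hca hs
      change evalHom A y (regularize (s / R) g) + κ • 1
        - evalHom A y (regularize s (constHom X A a)) = _
      rw [e1, e2]
      rfl
    rw [h3, hσ.map_sub, hσ.map_add, Complex.sub_re, Complex.add_re, hσ.re_smul]
    linarith
  rw [hτ.isPositiveTrace.map_sub, hτ.isPositiveTrace.map_add, Complex.sub_re, Complex.add_re,
    hτ.isPositiveTrace.re_smul, hτ.map_one, Complex.one_re] at key
  linarith

end ContinuousFunctions

lemma ApproxDivisible.continuousMap {X : Type*} [MetricSpace X] [CompactSpace X] {A : Type*}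
    [CStarAlgebra A] (hA : ApproxDivisible A) : ApproxDivisible C(X, A) := by
  intro N
  obtain ⟨φ, hφ⟩ := hA N
  refine ⟨fun k => (constHom X A).comp (φ k), fun z f => ?_⟩
  obtain ⟨C, hC⟩ := exists_norm_map_le z
  have hC0 : 0 ≤ C := (norm_nonneg _).trans (hC (φ 0))
  rw [Metric.tendsto_atTop]
  intro ε hε
  set η := ε / (2 * C + 2) with hη
  have hη0 : 0 < η := by positivity
  obtain ⟨t, ht⟩ := exists_finset_cover
    (U := fun x => {y | ‖f y - ContinuousMap.const X (f x) y‖ < η})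
    (fun x => isOpen_setOf_norm_sub_lt _ _ _) (fun x => by simpa using hη0)
  have hev : ∀ᶠ k in atTop, ∀ x ∈ t, ‖φ k z * f x - f x * φ k z‖ < η :=
    (Finset.eventually_all t).2 fun x _ => (hφ z (f x)).eventually (gt_mem_nhds hη0)
  obtain ⟨K, hK⟩ := eventually_atTop.1 hev
  refine ⟨K, fun k hk => ?_⟩
  rw [dist_zero_right, norm_norm]
  have hb : ‖constHom X A (φ k z) * f - f * constHom X A (φ k z)‖ ≤ η + 2 * C * η := by
    refine (ContinuousMap.norm_le _ (by positivity)).2 fun y => ?_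
    obtain ⟨x, hx, hy⟩ := ht y
    have hy' : ‖f y - f x‖ ≤ η := le_of_lt hy
    have e : (constHom X A (φ k z) * f - f * constHom X A (φ k z)) y
        = (φ k z * f x - f x * φ k z) + (φ k z * (f y - f x) - (f y - f x) * φ k z) := by
      change φ k z * f y - f y * φ k z = _
      noncomm_ring
    rw [e]
    calc _ ≤ ‖φ k z * f x - f x * φ k z‖ + (‖φ k z * (f y - f x)‖ + ‖(f y - f x) * φ k z‖) :=
          (norm_add_le _ _).trans (by gcongr; exact norm_sub_le _ _)
      _ ≤ η + (C * η + η * C) := by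
          gcongr
          · exact (hK k hk x hx).le
          · exact norm_mul_le_of_norm_le (hC _) hy'
          · exact norm_mul_le_of_norm_le hy' (hC _)
      _ = _ := by ring
  refine hb.trans_lt ?_
  rw [hη, show ε / (2 * C + 2) + 2 * C * (ε / (2 * C + 2)) = ε * ((2 * C + 1) / (2 * C + 2)) by ring]
  exact mul_lt_of_lt_one_right hε (by rw [div_lt_one (by positivity)]; linarith)

section Contraction

variable {A : Type*} [CStarAlgebra A]

lemma CuntzLE.map {B : Type*} [CStarAlgebra B] {a b : A} (h : CuntzLE a b) (φ : A →⋆ₐ[ℂ] B) :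
    CuntzLE (φ a) (φ b) := by
  rw [cuntzLE_iff_forall_exists_norm_lt] at h ⊢
  intro ε hε
  obtain ⟨v, hv⟩ := h ε hε
  refine ⟨φ v, ?_⟩
  rw [← map_star, ← map_mul, ← map_mul, ← map_sub]
  exact (NonUnitalStarAlgHom.norm_apply_le φ _).trans_lt hv

lemma CuntzEquiv.smul {a b : A} (h : CuntzEquiv b a) {r : ℝ} (hr : 0 < r) :
    CuntzEquiv (r • b) a :=
  ⟨cuntzLE_trans (cuntzLE_smul hr.le b) h.1, cuntzLE_trans h.2 (cuntzLE_of_smul hr b)⟩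

lemma exists_mem_spectrum_inv_smul {a : A} {α : ℝ} (hα : 0 < α)
    (h : ∀ ε : ℝ, 0 < ε → ∃ t : ℝ, t ∈ Set.Ioo 0 ε ∧ (t : ℂ) ∈ spectrum ℂ a) :
    ∀ ε > (0 : ℝ), ∃ t ∈ spectrum ℝ (α⁻¹ • a), 0 < t ∧ t < ε := by
  intro ε hε
  obtain ⟨t, ⟨ht0, htε⟩, ht⟩ := h (ε * α) (by positivity)
  have ht' : t ∈ spectrum ℝ a := (spectrum.algebraMap_mem_iff ℂ).1 ht
  refine ⟨α⁻¹ * t, ?_, by positivity, by rwa [inv_mul_lt_iff₀ hα, mul_comm]⟩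
  exact spectrum.smul_mem_smul_iff (r := Units.mk0 α⁻¹ (by positivity)).2 ht'

variable [PartialOrder A]

/-- The set of positive elements Cuntz equivalent to `a`. -/
abbrev CuntzClass (a : A) : Type _ := {b : A // 0 ≤ b ∧ CuntzEquiv b a}

lemma homotopic_of_forall_mem {X : Type*} [TopologicalSpace X] {a : A} (f g : C(X, CuntzClass a))
    (H : ℝ → X → A) (hH : Continuous fun p : ℝ × X => H p.1 p.2)
    (h0 : ∀ x, H 0 x = (f x : A)) (h1 : ∀ x, H 1 x = (g x : A))
    (hmem : ∀ t, 0 ≤ t → t ≤ 1 → ∀ x, 0 ≤ H t x ∧ CuntzEquiv (H t x) a) :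
    f.Homotopic g :=
  ⟨{ toFun := fun p => ⟨H p.1 p.2, hmem _ p.1.2.1 p.1.2.2 p.2⟩
     continuous_toFun := by
       refine Continuous.subtype_mk ?_ _
       exact hH.comp ((continuous_subtype_val.comp continuous_fst).prodMk continuous_snd)
     map_zero_left := fun x => Subtype.ext (h0 x)
     map_one_left := fun x => Subtype.ext (h1 x) }⟩

lemma exists_homotopic_of_forall_mem {X : Type*} [TopologicalSpace X] {a : A}
    (f : C(X, CuntzClass a))
    (H : ℝ → X → A) (hH : Continuous fun p : ℝ × X => H p.1 p.2)
    (h0 : ∀ x, H 0 x = (f x : A))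
    (hmem : ∀ t, 0 ≤ t → t ≤ 1 → ∀ x, 0 ≤ H t x ∧ CuntzEquiv (H t x) a) :
    ∃ g : C(X, CuntzClass a), (∀ x, (g x : A) = H 1 x) ∧ f.Homotopic g := by
  let g : C(X, CuntzClass a) := ⟨fun x => ⟨H 1 x, hmem 1 zero_le_one le_rfl x⟩,
    Continuous.subtype_mk (hH.comp (continuous_const.prodMk continuous_id)) _⟩
  exact ⟨g, fun _ => rfl, homotopic_of_forall_mem f g H hH h0 (fun _ => rfl) hmem⟩

variable [StarOrderedRing A]

lemma inv_smul_le_one {b : A} (hb : IsSelfAdjoint b) {c : ℝ} (hc : 0 < c) (h : ‖b‖ ≤ c) :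
    c⁻¹ • b ≤ 1 := by
  have h1 := smul_le_smul_of_nonneg_left
    (hb.le_algebraMap_norm_self.trans (algebraMap_mono A h)) (inv_nonneg.2 hc.le)
  rwa [Algebra.algebraMap_eq_smul_one, smul_smul, inv_mul_cancel₀ hc.ne', one_smul] at h1

lemma isUnit_smul_one_add_I_smul {k : A} (hk : IsSelfAdjoint k) {r : ℝ} (hr : 0 < r) (s : ℝ) :
    IsUnit ((r : ℂ) • (1 : A) + ((s : ℂ) * Complex.I) • k) := by
  set v := (r : ℂ) • (1 : A) + ((s : ℂ) * Complex.I) • k with hv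
  have hstar : star v = (r : ℂ) • (1 : A) - ((s : ℂ) * Complex.I) • k := by
    rw [hv, star_add, star_smul, star_smul, star_one, hk.star_eq]
    simp [sub_eq_add_neg]
  have hp : 0 ≤ (s • k) * (s • k) := by
    have := star_mul_self_nonneg (s • k)
    rwa [star_smul, hk.star_eq, star_trivial] at this
  have hI : ((s : ℂ) * Complex.I) * ((s : ℂ) * Complex.I) = -((s : ℂ) * s) := by
    linear_combination ((s : ℂ) * s) * Complex.I_mul_I
  have h1 : (s • k) * (s • k) + (r ^ 2) • (1 : A)
      = ((s : ℂ) * s) • (k * k) + ((r : ℂ) * r) • (1 : A) := by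
    rw [smul_mul_smul_comm, ← Complex.coe_smul (s * s), ← Complex.coe_smul (r ^ 2), sq,
      Complex.ofReal_mul, Complex.ofReal_mul]
  have h2 : v * star v = (s • k) * (s • k) + (r ^ 2) • (1 : A) := by
    rw [h1, hstar, hv, add_mul, mul_sub, mul_sub]
    simp only [smul_mul_smul_comm, hI, one_mul, mul_one, neg_smul]
    rw [mul_comm (r : ℂ) (s * Complex.I)]
    abel
  have h3 : star v * v = (s • k) * (s • k) + (r ^ 2) • (1 : A) := by
    rw [h1, hstar, hv, sub_mul, mul_add, mul_add]
    simp only [smul_mul_smul_comm, hI, one_mul, mul_one, neg_smul]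
    rw [mul_comm (r : ℂ) (s * Complex.I)]
    abel
  have hr2 : 0 < r ^ 2 := by positivity
  refine isUnit_iff_exists_and_exists.2 ⟨⟨star v * resolventAt (r ^ 2) (s • k * s • k), ?_⟩,
    ⟨resolventAt (r ^ 2) (s • k * s • k) * star v, ?_⟩⟩
  · rw [← mul_assoc, h2, mul_resolventAt hp hr2]
  · rw [mul_assoc, h3, resolventAt_mul hp hr2]

lemma isUnit_smul_one_add_smul {E : A} (hE : 0 ≤ E) {r s : ℝ} (hr : 0 < r) (hs : 0 ≤ s) :
    IsUnit (r • (1 : A) + s • E) := by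
  have h := smul_nonneg hs hE
  rw [add_comm]
  exact isUnit_iff_exists.2 ⟨_, mul_resolventAt h hr, resolventAt_mul h hr⟩

lemma nonneg_and_cuntzEquiv_conj {a b v : A} (hb : 0 ≤ b) (hba : CuntzLE b a)
    (h : CuntzLE a (v * b * star v)) :
    0 ≤ v * b * star v ∧ CuntzEquiv (v * b * star v) a :=
  ⟨star_right_conjugate_nonneg hb v, cuntzLE_trans (cuntzLE_conj v b) hba, h⟩

lemma cuntzEquiv_convexCombination {a m : A} (ha : 0 ≤ a) (hm : 0 ≤ m) {C : ℝ}
    (hma : m ≤ C • a) (hC : 0 ≤ C) {t : ℝ} (ht : 0 < t) (ht1 : t ≤ 1) :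
    CuntzEquiv ((1 - t) • m + t • a) a := by
  have h1 : 0 ≤ (1 - t) • m := smul_nonneg (by linarith) hm
  have h2 : 0 ≤ t • a := smul_nonneg ht.le ha
  constructor
  · refine cuntzLE_trans (cuntzLE_of_le (add_nonneg h1 h2) ?_)
      (cuntzLE_smul (r := (1 - t) * C + t) (by nlinarith) a)
    rw [add_smul, mul_smul]
    gcongr
  · exact cuntzLE_trans (cuntzLE_of_smul ht a) (cuntzLE_of_le h2 (le_add_of_nonneg_left h1))

/-- Every map from a compact metric space into the Cuntz class of `a` is freely homotopic to a
constant map. -/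
theorem homotopic_const_of_cuntzClass (hA : CStarSimple A) (hAD : ApproxDivisible A)
    {X : Type} [MetricSpace X] [CompactSpace X] (hSC : StrictComparison C(X, A))
    {a : A} (ha : 0 ≤ a) (ha0 : a ≠ 0)
    (hnc : ∀ ε : ℝ, 0 < ε → ∃ t : ℝ, t ∈ Set.Ioo 0 ε ∧ (t : ℂ) ∈ spectrum ℂ a)
    (f : C(X, CuntzClass a)) :
    f.Homotopic (ContinuousMap.const X ⟨a, ha, cuntzEquiv_refl a⟩) := by
  let G : C(X, A) := ⟨fun x => f x, by fun_prop⟩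
  have hG : 0 ≤ G := fun x => (f x).2.1
  set c := ‖G‖ + 1 with hc
  have hc0 : 0 < c := by positivity
  set α := ‖a‖ with hα
  have hα0 : 0 < α := norm_pos_iff.2 ha0
  let a₀ := α⁻¹ • a
  have ha₀ : 0 ≤ a₀ := smul_nonneg (by positivity) ha
  have haa₀ : CuntzLE a a₀ := cuntzLE_of_smul (by positivity) a
  have ha₀1 : a₀ ≤ 1 := inv_smul_le_one ha.isSelfAdjoint hα0 le_rfl
  let g : C(X, A) := c⁻¹ • G
  have hg : 0 ≤ g := smul_nonneg (by positivity) hG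
  have hg1 : g ≤ 1 := inv_smul_le_one hG.isSelfAdjoint hc0 (by simp [hc])
  have hg0 : ∀ x, 0 ≤ g x := fun x => hg x
  have hgmem : ∀ x, 0 ≤ g x ∧ CuntzEquiv (g x) a := fun x => ⟨hg x, (f x).2.2.smul (by positivity)⟩
  obtain ⟨k, hk, hak⟩ := exists_isSelfAdjoint_cuntzLE_conj (B := C(X, A)) hAD.continuousMap hSC
    (a := constHom X A a₀) (g := g) (map_nonneg _ ha₀) (fun _ => ha₀1) hg hg1
    ((hasTraceGaps_of_spectrum hA ha₀.isSelfAdjoint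
      (exists_mem_spectrum_inv_smul hα0 hnc)).map ha₀.isSelfAdjoint _)
    (traceDominated_const ha₀ hg fun x => cuntzLE_trans (cuntzLE_smul (by positivity) a) (hgmem x).2.2)
  set E := CFC.sqrt (constHom X A a₀) with hE
  have hE0 : ∀ x, 0 ≤ E x := fun x => CFC.sqrt_nonneg (constHom X A a₀) x
  have hEsq : ∀ x, E x * E x = a₀ := fun x =>
    congrArg (fun h : C(X, A) => h x) (CFC.sqrt_mul_sqrt_self (constHom X A a₀) (map_nonneg _ ha₀))
  have hEs : ∀ x, star (E x) = E x := fun x => (hE0 x).isSelfAdjoint.star_eq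
  have hks : ∀ x, star (k x) = k x := fun x => congrArg (fun h : C(X, A) => h x) hk.star_eq
  have hax : ∀ x, CuntzLE a (E x * (k x * g x * k x) * star (E x)) := fun x => by
    refine cuntzLE_trans haa₀ ?_
    have := hak.map (evalHom A x)
    rw [hEs]
    change CuntzLE a₀ (E x * k x * g x * k x * E x) at this
    simpa only [mul_assoc] using this
  have hn : ∀ x, 0 ≤ k x * g x * k x := fun x => by
    simpa only [hks] using star_right_conjugate_nonneg (hg0 x) (k x)
  have hna : ∀ x, CuntzLE (k x * g x * k x) a := fun x => by
    simpa only [hks] using cuntzLE_trans (cuntzLE_conj (k x) (g x)) (hgmem x).2.1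
  have hI : ∀ x, (((1 - 1 : ℝ) : ℂ) • (1 : A) + (((1 : ℝ) : ℂ) * Complex.I) • k x) * g x
      * star (((1 - 1 : ℝ) : ℂ) • (1 : A) + (((1 : ℝ) : ℂ) * Complex.I) • k x)
      = k x * g x * k x := fun x => by
    simp [hks, smul_smul]
  obtain ⟨f₁, hf₁, H₁⟩ := exists_homotopic_of_forall_mem f
    (fun t x => ((1 - t) + t * c⁻¹) • G x) (by fun_prop) (fun x => by simp [G])
    (fun t ht ht1 x => by
      have h : 0 < (1 - t) + t * c⁻¹ := by
        rcases ht1.lt_or_eq with h | rfl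
        · have : 0 ≤ t * c⁻¹ := by positivity
          linarith
        · simpa using hc0
      exact ⟨smul_nonneg h.le (hG x), (f x).2.2.smul h⟩)
  obtain ⟨f₂, hf₂, H₂⟩ := exists_homotopic_of_forall_mem f₁
    (fun t x => (((1 - t : ℝ) : ℂ) • (1 : A) + ((t : ℂ) * Complex.I) • k x) * g x
      * star (((1 - t : ℝ) : ℂ) • (1 : A) + ((t : ℂ) * Complex.I) • k x))
    (by fun_prop) (fun x => by simp [hf₁, g])
    (fun t ht ht1 x => by
      refine nonneg_and_cuntzEquiv_conj (hg x) (hgmem x).2.1 ?_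
      rcases ht1.lt_or_eq with h | rfl
      · exact cuntzLE_trans (hgmem x).2.2 (cuntzLE_conj_of_isUnit
          (isUnit_smul_one_add_I_smul (congrArg (fun h : C(X, A) => h x) hk.star_eq)
            (sub_pos.2 h) t) _)
      · refine cuntzLE_trans (hax x) ?_
        rw [hI]
        exact cuntzLE_conj (E x) _)
  obtain ⟨f₃, hf₃, H₃⟩ := exists_homotopic_of_forall_mem f₂
    (fun t x => ((1 - t) • (1 : A) + t • E x) * (k x * g x * k x)
      * star ((1 - t) • (1 : A) + t • E x))
    (by fun_prop) (fun x => by rw [hf₂, hI]; simp)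
    (fun t ht ht1 x => by
      refine nonneg_and_cuntzEquiv_conj (hn x) (hna x) ?_
      rcases ht1.lt_or_eq with h | rfl
      · exact cuntzLE_trans (cuntzLE_trans (hax x) (cuntzLE_conj _ _))
          (cuntzLE_conj_of_isUnit (isUnit_smul_one_add_smul (hE0 x) (sub_pos.2 h) ht) _)
      · simpa using hax x)
  refine H₁.trans (H₂.trans (H₃.trans (homotopic_of_forall_mem _ _
    (fun t x => (1 - t) • (E x * (k x * g x * k x) * E x) + t • a) (by fun_prop)
    (fun x => by simp [hf₃, hEs]) (fun x => by simp) fun t ht ht1 x => ?_)))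
  have hm : 0 ≤ E x * (k x * g x * k x) * E x := by
    simpa only [hEs] using star_right_conjugate_nonneg (hn x) (E x)
  refine ⟨add_nonneg (smul_nonneg (by linarith) hm) (smul_nonneg ht ha), ?_⟩
  rcases ht.eq_or_lt with rfl | ht
  · have := (nonneg_and_cuntzEquiv_conj (hn x) (hna x) (hax x)).2
    simpa [hEs] using this
  · refine cuntzEquiv_convexCombination ha hm (C := ‖k x * g x * k x‖ * α⁻¹) ?_ (by positivity) ht ht1
    have h := star_right_conjugate_le_conjugate (hn x).isSelfAdjoint.le_algebraMap_norm_self (E x)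
    rw [hEs, Algebra.algebraMap_eq_smul_one, mul_smul_comm, smul_mul_assoc, mul_one, hEsq] at h
    rwa [mul_smul]

end Contraction

section Homotopy

open scoped unitInterval

variable {Y : Type*} [TopologicalSpace Y]

lemma homotopicRel_of_forall {X : Type*} [TopologicalSpace X] {S : Set X} {f g : C(X, Y)}
    (H : I × X → Y) (hH : Continuous H) (h0 : ∀ x, H (0, x) = f x) (h1 : ∀ x, H (1, x) = g x)
    (hS : ∀ t, ∀ x ∈ S, H (t, x) = f x) : f.HomotopicRel g S :=
  ⟨{ toFun := H
     continuous_toFun := hH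
     map_zero_left := h0
     map_one_left := h1
     prop' := fun t x hx => hS t x hx }⟩

/-- The map collapsing the boundary of the cube to a point. -/
noncomputable def collapse (k : ℕ) (x : Fin k → I) : (Fin k → ℝ) × ℝ :=
  (fun j => (∏ i, (x i : ℝ) * (1 - x i)) * x j, ∏ i, (x i : ℝ) * (1 - x i))

lemma continuous_collapse (k : ℕ) : Continuous (collapse k) := by
  unfold collapse; fun_prop

lemma prod_eq_zero_iff_mem_boundary {k : ℕ} {x : Fin k → I} :
    ∏ i, (x i : ℝ) * (1 - x i) = 0 ↔ x ∈ Cube.boundary (Fin k) := by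
  simp only [Finset.prod_eq_zero_iff, Finset.mem_univ, true_and, mul_eq_zero, sub_eq_zero,
    Cube.boundary, Set.mem_ofPred_eq]
  refine exists_congr fun i => or_congr (by simp) ?_
  rw [eq_comm]; simp

lemma collapse_of_mem_boundary {k : ℕ} {x : Fin k → I} (hx : x ∈ Cube.boundary (Fin k)) :
    collapse k x = 0 := by
  have := prod_eq_zero_iff_mem_boundary.2 hx
  ext <;> simp [collapse, this]

lemma eq_or_mem_boundary_of_collapse_eq {k : ℕ} {x y : Fin k → I}
    (h : collapse k x = collapse k y) :
    x = y ∨ x ∈ Cube.boundary (Fin k) ∧ y ∈ Cube.boundary (Fin k) := by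
  have h2 := congrArg Prod.snd h
  simp only [collapse] at h2
  rw [← prod_eq_zero_iff_mem_boundary, ← prod_eq_zero_iff_mem_boundary, ← h2, and_self]
  refine or_iff_not_imp_right.2 fun h0 => ?_
  ext j
  have h1 := congrFun (congrArg Prod.fst h) j
  simp only [collapse, ← h2] at h1
  exact mul_left_cancel₀ h0 h1

/-- A family of maps of the unit interval expanding the middle third to the whole interval. -/
noncomputable def expand (r x : I) : I :=
  Set.projIcc 0 1 zero_le_one ((1 + 2 * r) * x - r : ℝ)

lemma continuous_expand : Continuous fun p : I × I => expand p.1 p.2 :=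
  continuous_projIcc.comp (by fun_prop)

lemma expand_zero_left (x : I) : expand 0 x = x := by simp [expand]

lemma expand_zero (r : I) : expand r 0 = 0 :=
  Set.projIcc_of_le_left _ (by simpa using r.2.1)

lemma expand_one (r : I) : expand r 1 = 1 :=
  Set.projIcc_of_right_le _ (by have := r.2.1; simp; linarith)

/-- A function vanishing at the endpoints and equal to one on the middle third. -/
noncomputable def plateau (x : I) : I :=
  Set.projIcc 0 1 zero_le_one (3 * min (x : ℝ) (1 - x))

lemma continuous_plateau : Continuous plateau :=
  continuous_projIcc.comp (by fun_prop)

lemma plateau_zero : plateau 0 = 0 := Set.projIcc_of_le_left _ (by simp)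

lemma plateau_one : plateau 1 = 0 := Set.projIcc_of_le_left _ (by simp)

lemma plateau_eq_one {x : I} (h0 : expand 1 x ≠ 0) (h1 : expand 1 x ≠ 1) : plateau x = 1 := by
  have h0' : ¬ ((1 + 2 * (1 : I)) * x - (1 : I) : ℝ) ≤ 0 := fun h =>
    h0 (Set.projIcc_of_le_left _ h)
  have h1' : ¬ 1 ≤ ((1 + 2 * (1 : I)) * x - (1 : I) : ℝ) := fun h =>
    h1 (Set.projIcc_of_right_le _ h)
  simp only [Set.Icc.coe_one] at h0' h1'
  refine Set.projIcc_of_right_le _ ?_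
  have : 1 / 3 ≤ min (x : ℝ) (1 - x) := le_min (by linarith) (by linarith)
  linarith

lemma expand_mem_boundary {k : ℕ} (r : I) {x : Fin k → I} (hx : x ∈ Cube.boundary (Fin k)) :
    (fun i => expand r (x i)) ∈ Cube.boundary (Fin k) := by
  obtain ⟨i, h | h⟩ := hx
  · exact ⟨i, .inl (by simp only [h, expand_zero])⟩
  · exact ⟨i, .inr (by simp only [h, expand_one])⟩

lemma prod_plateau_of_mem_boundary {k : ℕ} {x : Fin k → I} (hx : x ∈ Cube.boundary (Fin k)) :
    ∏ i, plateau (x i) = 0 := by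
  obtain ⟨i, h | h⟩ := hx
  · exact Finset.prod_eq_zero (Finset.mem_univ i) (by rw [h, plateau_zero])
  · exact Finset.prod_eq_zero (Finset.mem_univ i) (by rw [h, plateau_one])

lemma prod_plateau_eq_one {k : ℕ} {x : Fin k → I}
    (hx : (fun i => expand 1 (x i)) ∉ Cube.boundary (Fin k)) : ∏ i, plateau (x i) = 1 :=
  Finset.prod_eq_one fun i _ => plateau_eq_one (fun h => hx ⟨i, .inl h⟩) fun h => hx ⟨i, .inr h⟩

/-- A free null-homotopy of a based map of a sphere, viewed as a homotopy on the cube which on the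
boundary only depends on time, can be replaced by a based one. -/
lemma homotopicRel_const_of_free {k : ℕ} {y : Y} {f : C(Fin k → I, Y)}
    (hf : ∀ x ∈ Cube.boundary (Fin k), f x = y) (H : C(I × (Fin k → I), Y)) (γ : C(I, Y))
    (h0 : ∀ x, H (0, x) = f x) (h1 : ∀ x, H (1, x) = y) (hγ0 : γ 0 = y) (hγ1 : γ 1 = y)
    (hγ : ∀ t, ∀ x ∈ Cube.boundary (Fin k), H (t, x) = γ t) :
    f.HomotopicRel (ContinuousMap.const _ y) (Cube.boundary (Fin k)) := by
  have hexp : Continuous fun p : I × (Fin k → I) => fun i => expand p.1 (p.2 i) :=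
    continuous_pi fun i => continuous_expand.comp
      (continuous_fst.prodMk ((continuous_apply i).comp continuous_snd))
  have hexp1 : Continuous fun x : Fin k → I => fun i => expand 1 (x i) :=
    hexp.comp (continuous_const.prodMk continuous_id)
  have hlam : Continuous fun x : Fin k → I => ∏ i, plateau (x i) :=
    continuous_finsetProd _ fun i _ => continuous_plateau.comp (continuous_apply i)
  let f₁ : C(Fin k → I, Y) := ⟨fun x => f fun i => expand 1 (x i), f.continuous.comp hexp1⟩
  let f₂ : C(Fin k → I, Y) := ⟨fun x => γ (∏ i, plateau (x i)), γ.continuous.comp hlam⟩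
  have H₁ : f.HomotopicRel f₁ (Cube.boundary (Fin k)) :=
    homotopicRel_of_forall (fun p => f fun i => expand p.1 (p.2 i)) (f.continuous.comp hexp)
      (fun x => by simp only [expand_zero_left]) (fun x => rfl)
      fun t x hx => by rw [hf x hx]; exact hf _ (expand_mem_boundary t hx)
  have H₂ : f₁.HomotopicRel f₂ (Cube.boundary (Fin k)) := by
    refine homotopicRel_of_forall
      (fun p => H (p.1 * ∏ i, plateau (p.2 i), fun i => expand 1 (p.2 i)))
      (H.continuous.comp ((continuous_fst.mul (hlam.comp continuous_snd)).prodMk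
        (hexp1.comp continuous_snd)))
      (fun x => by simp only [zero_mul, h0]; rfl) (fun x => ?_) fun t x hx => ?_
    · rw [one_mul]
      by_cases hx : (fun i => expand 1 (x i)) ∈ Cube.boundary (Fin k)
      · exact hγ _ _ hx
      · change _ = γ (∏ i, plateau (x i))
        rw [prod_plateau_eq_one hx, h1, hγ1]
    · simp only [prod_plateau_of_mem_boundary hx, mul_zero, h0]
      rfl
  have H₃ : f₂.HomotopicRel (ContinuousMap.const _ y) (Cube.boundary (Fin k)) := by
    refine homotopicRel_of_forall (fun p => γ (σ p.1 * ∏ i, plateau (p.2 i)))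
      (γ.continuous.comp ((unitInterval.continuous_symm.comp continuous_fst).mul
        (hlam.comp continuous_snd)))
      (fun x => by simp only [unitInterval.symm_zero, one_mul]; rfl)
      (fun x => by simp only [unitInterval.symm_one, zero_mul, hγ0]; rfl) fun t x hx => ?_
    change _ = γ (∏ i, plateau (x i))
    simp only [prod_plateau_of_mem_boundary hx, mul_zero]
  exact H₁.trans (H₂.trans H₃)

/-- A space into which all maps from compact metric spaces are null-homotopic has vanishing
homotopy groups. -/
theorem pathConnectedSpace_and_subsingleton_homotopyGroup (y : Y)
    (h : ∀ (X : Type) [MetricSpace X] [CompactSpace X] (f : C(X, Y)),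
      f.Homotopic (ContinuousMap.const X y)) :
    PathConnectedSpace Y ∧ ∀ k : ℕ, 1 ≤ k → Subsingleton (HomotopyGroup (Fin k) Y y) := by
  refine ⟨?_, fun k hk => ?_⟩
  · have hj : ∀ z, Joined z y := fun z => by
      obtain ⟨H⟩ := h Unit (ContinuousMap.const _ z)
      exact ⟨{ toFun := fun t => H (t, ())
               continuous_toFun := by fun_prop
               source' := by simp
               target' := by simp }⟩
    exact ⟨⟨y⟩, fun z w => (hj z).trans (hj w).symm⟩
  have hnull : ∀ f : GenLoop (Fin k) Y y, GenLoop.Homotopic f GenLoop.const := fun f => by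
    let X := Set.range (collapse k)
    have : CompactSpace X := isCompact_iff_compactSpace.1 (isCompact_range (continuous_collapse k))
    let c : C(Fin k → I, X) := ⟨Set.rangeFactorization (collapse k),
      (continuous_collapse k).subtype_mk _⟩
    have hc : IsQuotientMap c :=
      c.continuous.isClosedMap.isQuotientMap c.continuous Set.rangeFactorization_surjective
    have hfac : Function.FactorsThrough f.1 c := fun x z hxz => by
      rcases eq_or_mem_boundary_of_collapse_eq (congrArg Subtype.val hxz) with rfl | ⟨hx, hz⟩
      · rfl
      · exact (f.2 x hx).trans (f.2 z hz).symm
    obtain ⟨H⟩ := h X (hc.lift f.1 hfac)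
    have hlift : ∀ x, hc.lift f.1 hfac (c x) = f.1 x := fun x =>
      congrArg (fun g : C(Fin k → I, Y) => g x) (hc.lift_comp f.1 hfac)
    have h0b : (fun _ => 0) ∈ Cube.boundary (Fin k) := ⟨⟨0, hk⟩, .inl rfl⟩
    refine homotopicRel_const_of_free (y := y) f.2 ⟨fun p => H (p.1, c p.2), by fun_prop⟩
      ⟨fun t => H (t, c fun _ => 0), by fun_prop⟩ (fun x => ?_) (fun x => ?_) ?_ ?_
      fun t x hx => ?_
    · change H (0, c x) = _
      rw [H.apply_zero, hlift]
    · exact H.apply_one _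
    · change H (0, c _) = _
      rw [H.apply_zero, hlift]
      exact f.2 _ h0b
    · exact H.apply_one _
    · have : c x = c fun _ => 0 := Subtype.ext
        ((collapse_of_mem_boundary hx).trans (collapse_of_mem_boundary h0b).symm)
      change H (t, c x) = H (t, c _)
      rw [this]
  refine ⟨fun p q => ?_⟩
  induction p using Quotient.inductionOn with | _ p
  induction q using Quotient.inductionOn with | _ q
  exact Quotient.sound ((hnull p).trans (hnull q).symm)

end Homotopy

/-- **Corollary (vanishing homotopy groups).**
Under the hypotheses of the main theorem, the Cuntz class
`D_a = { b ∈ A | b ≥ 0, b ∼ a }` (with the subspace topology and basepoint `a`)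
is path connected and has trivial homotopy groups `π_k` for all `k ≥ 1`. -/
theorem homotopy_groups_of_cuntz_class_vanish
    {A : Type*} [CStarAlgebra A] [PartialOrder A] [StarOrderedRing A]
    [TopologicalSpace.SeparableSpace A]
    (hSimple : CStarSimple A) (hAD : ApproxDivisible A)
    (hRR0 : RealRankZero A) (hSF : StablyFinite A)
    (hSC : ∀ (X : Type) [MetricSpace X] [CompactSpace X], StrictComparison C(X, A))
    (a : A) (ha : 0 ≤ a) (ha0 : a ≠ 0)
    (hnc : ∀ ε : ℝ, 0 < ε → ∃ t : ℝ, t ∈ Set.Ioo 0 ε ∧ (t : ℂ) ∈ spectrum ℂ a) :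
    PathConnectedSpace {b : A // 0 ≤ b ∧ CuntzEquiv b a} ∧
    ∀ k : ℕ, 1 ≤ k →
      Subsingleton (HomotopyGroup (Fin k) {b : A // 0 ≤ b ∧ CuntzEquiv b a}
        ⟨a, ha, cuntzEquiv_refl a⟩) := by
  exact pathConnectedSpace_and_subsingleton_homotopyGroup
    (Y := CuntzClass a) ⟨a, ha, cuntzEquiv_refl a⟩
    fun X _ _ f => homotopic_const_of_cuntzClass hSimple hAD (hSC X) ha ha0 hnc f
end

section
/- Let B be a C*-algebra and let f, b ∈ B be positive elements with b in the norm closure of f·B·f. Then for every t ∈ [0,1), the element (1−t)f + tb is Cuntz equivalent to f. Consequently, if in addition b is Cuntz equivalent to f, then the straight-line path h(t) = (1−t)f + tb, t ∈ [0,1], satisfies h(t) ∼ f for every t ∈ [0,1], so it is a path from f to b lying entirely within the Cuntz equivalence class of f. -/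
open Filter Topology

lemma cuntzLE_of_forall_norm_le {B : Type*} [NonUnitalNormedRing B] [StarRing B] {a b : B}
    (H : ∀ ε : ℝ, 0 < ε → ∃ v : B, ‖v * b * star v - a‖ ≤ ε) : CuntzLE a b := by
  choose! v hv using H
  refine ⟨fun n => v (1 / ((n : ℝ) + 1)), ?_⟩
  exact squeeze_zero (fun _ => norm_nonneg _) (fun n => hv _ Nat.one_div_pos_of_nat)
    tendsto_one_div_add_atTop_nhds_zero_nat

/-- If `a ≤ C b + ε` in the unitization for every `ε > 0`, with `C` depending on `ε`, then `a ≾ b`: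
the elements `v = a^{1/2} (C b + ε)^{-1/2}` satisfy `‖v (C b) v* - a‖ ≤ ε`. -/
lemma cuntzLE_of_forall_le_smul_add {B : Type*} [NonUnitalCStarAlgebra B] [PartialOrder B]
    [StarOrderedRing B] {a b : B} (ha : 0 ≤ a) (hb : 0 ≤ b)
    (H : ∀ ε : ℝ, 0 < ε → ∃ C : ℝ, 0 ≤ C ∧
      (a : Unitization ℂ B) ≤ ((C • b : B) : Unitization ℂ B) + algebraMap ℝ _ ε) :
    CuntzLE a b := by
  refine cuntzLE_of_forall_norm_le fun ε hε => ?_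
  obtain ⟨C, hC, hle⟩ := H ε hε
  set c : Unitization ℂ B := ((C • b : B) : Unitization ℂ B) + algebraMap ℝ _ ε with hc
  have hCb : (0 : Unitization ℂ B) ≤ ((C • b : B) : Unitization ℂ B) :=
    Unitization.inr_nonneg_iff.mpr (smul_nonneg hC hb)
  have hε' : IsStrictlyPositive (algebraMap ℝ (Unitization ℂ B) ε) :=
    isStrictlyPositive_algebraMap hε
  have hcpos : IsStrictlyPositive c := hε'.nonneg_add hCb
  have ha' : (0 : Unitization ℂ B) ≤ (a : Unitization ℂ B) := Unitization.inr_nonneg_iff.mpr ha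
  have hnorm : ‖CFC.sqrt (a : Unitization ℂ B) * c ^ (-(1 / 2) : ℝ)‖ ≤ 1 :=
    (le_iff_norm_sqrt_mul_rpow (a : Unitization ℂ B) c ha' hcpos).mp hle
  set d : Unitization ℂ B := c ^ (-(1 / 2) : ℝ) with hd
  have hdcd : d * c * d = 1 := CFC.conjugate_rpow_neg_one_half c hcpos
  have hdsa : star d = d := (CFC.rpow_nonneg (a := c)).isSelfAdjoint.star_eq
  set s : B := CFC.sqrt a with hs
  have hsa : star s = s := (CFC.sqrt_nonneg a).isSelfAdjoint.star_eq
  have hss : s * s = a := CFC.sqrt_mul_sqrt_self a ha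
  rw [Unitization.sqrt_inr, ← hs] at hnorm
  obtain ⟨v, hv⟩ : ∃ v : B, (v : Unitization ℂ B) = s * d :=
    ⟨((s : Unitization ℂ B) * d).snd, by ext <;> simp⟩
  refine ⟨√C • v, ?_⟩
  have key : (((√C • v) * b * star (√C • v) - a : B) : Unitization ℂ B)
      = -(ε • ((v : Unitization ℂ B) * star (v : Unitization ℂ B))) := by
    have h1 : (√C • v) * b * star (√C • v) = v * (C • b) * star v := by
      simp only [star_smul, star_trivial, smul_mul_assoc, mul_smul_comm, smul_smul,
        Real.mul_self_sqrt hC]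
    have h2 : ((C • b : B) : Unitization ℂ B) = c - algebraMap ℝ _ ε := by rw [hc]; abel
    have h3 : (a : Unitization ℂ B) = s * (d * c * d) * s := by
      rw [hdcd, mul_one, ← Unitization.inr_mul, hss]
    have h4 : star (v : Unitization ℂ B) = d * s := by
      rw [hv, star_mul, hdsa, ← Unitization.inr_star, hsa]
    rw [h1, Unitization.inr_sub, Unitization.inr_mul, Unitization.inr_mul, Unitization.inr_star,
      h2, h4, hv, h3, Algebra.algebraMap_eq_smul_one]
    simp only [mul_sub, sub_mul, mul_smul_comm, smul_mul_assoc, mul_one, mul_assoc]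
    abel
  rw [← Unitization.norm_inr (𝕜 := ℂ), key, norm_neg, norm_smul, CStarRing.norm_self_mul_star,
    Real.norm_of_nonneg hε.le, hv]
  have := norm_nonneg ((s : Unitization ℂ B) * d)
  nlinarith [mul_le_one₀ hnorm this hnorm]

lemma mul_self_le_norm_smul {B : Type*} [NonUnitalCStarAlgebra B] [PartialOrder B]
    [StarOrderedRing B] {f : B} (hf : 0 ≤ f) : f * f ≤ ‖f‖ • f := by
  have hsa : star (CFC.sqrt f) = CFC.sqrt f := (CFC.sqrt_nonneg f).isSelfAdjoint.star_eq
  have hss : CFC.sqrt f * CFC.sqrt f = f := CFC.sqrt_mul_sqrt_self f hf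
  have h := CStarAlgebra.star_left_conjugate_le_norm_smul (a := CFC.sqrt f) (b := f)
    hf.isSelfAdjoint
  rw [hsa, hss] at h
  calc f * f = CFC.sqrt f * f * CFC.sqrt f := by
        have h2 : CFC.sqrt f * (CFC.sqrt f * CFC.sqrt f) * CFC.sqrt f
            = (CFC.sqrt f * CFC.sqrt f) * (CFC.sqrt f * CFC.sqrt f) := by simp only [mul_assoc]
        rw [hss] at h2
        exact h2.symm
    _ ≤ _ := h

/-- A self-adjoint element of the hereditary subalgebra generated by `f ≥ 0` is dominated by
multiples of `f` up to arbitrarily small scalars. -/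
lemma exists_le_smul_add_of_mem_herSet {B : Type*} [NonUnitalCStarAlgebra B] [PartialOrder B]
    [StarOrderedRing B] {f b : B} (hf : 0 ≤ f) (hb : IsSelfAdjoint b) (hmem : b ∈ herSet f)
    {ε : ℝ} (hε : 0 < ε) : ∃ C : ℝ, 0 ≤ C ∧
      (b : Unitization ℂ B) ≤ ((C • f : B) : Unitization ℂ B) + algebraMap ℝ _ ε := by
  obtain ⟨y, ⟨x, rfl⟩, hxy⟩ := Metric.mem_closure_iff.mp hmem ε hε
  rw [dist_eq_norm] at hxy
  have hfs : star f = f := hf.isSelfAdjoint.star_eq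
  set z : B := (2⁻¹ : ℝ) • (x + star x) with hz
  have hzsa : IsSelfAdjoint z := (IsSelfAdjoint.all (2⁻¹ : ℝ)).smul (.add_star_self x)
  have hdist : ‖b - f * z * f‖ ≤ ε := by
    have h1 : b - f * z * f = (2⁻¹ : ℝ) • ((b - f * x * f) + star (b - f * x * f)) := by
      have h2 : b = (2⁻¹ : ℝ) • (b + b) := by rw [← two_smul ℝ b, smul_smul]; norm_num
      rw [star_sub, hb.star_eq, star_mul, star_mul, hfs, hz]
      nth_rw 1 [h2]
      simp only [mul_smul_comm, smul_mul_assoc, ← smul_sub, mul_add, add_mul, mul_assoc]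
      congr 1
      abel
    rw [h1, norm_smul, Real.norm_of_nonneg (by norm_num)]
    have := norm_add_le (b - f * x * f) (star (b - f * x * f))
    rw [norm_star] at this
    linarith
  have hfz : f * z * f ≤ (‖z‖ * ‖f‖) • f := by
    have h := CStarAlgebra.star_left_conjugate_le_norm_smul (a := f) (b := z) hzsa
    rw [hfs] at h
    refine h.trans ?_
    rw [mul_smul]
    exact smul_le_smul_of_nonneg_left (mul_self_le_norm_smul hf) (norm_nonneg z)
  have hfzsa : IsSelfAdjoint (f * z * f) := by
    have := hzsa.conjugate f
    rwa [hfs] at this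
  refine ⟨‖z‖ * ‖f‖, by positivity, ?_⟩
  have h1 : ((f * z * f : B) : Unitization ℂ B) ≤ (((‖z‖ * ‖f‖) • f : B) : Unitization ℂ B) :=
    (Unitization.inr_le_iff _ _ hfzsa ((IsSelfAdjoint.all (‖z‖ * ‖f‖)).smul hf.isSelfAdjoint)).mpr hfz
  have h2 : ((b - f * z * f : B) : Unitization ℂ B) ≤ algebraMap ℝ _ ε := by
    have h3 : IsSelfAdjoint ((b - f * z * f : B) : Unitization ℂ B) :=
      (hb.sub hfzsa).inr ℂ
    refine h3.le_algebraMap_norm_self.trans ?_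
    rw [Unitization.norm_inr]
    exact algebraMap_mono _ hdist
  calc (b : Unitization ℂ B) = ((f * z * f : B) : Unitization ℂ B)
        + ((b - f * z * f : B) : Unitization ℂ B) := by
        rw [← Unitization.inr_add]; congr 1; abel
    _ ≤ _ := add_le_add h1 h2

/-- **(Straight-line homotopies stay in the Cuntz class.)**
Let `f, b` be positive elements of a C*-algebra `B` with `b` in the norm closure of
`f·B·f`.  Then `(1−t)f + tb ∼ f` for every `t ∈ [0,1)`; and if moreover `b ∼ f`,
then `(1−t)f + tb ∼ f` for every `t ∈ [0,1]`, so the straight-line path from `f`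
to `b` lies entirely within the Cuntz class of `f`. -/
theorem straight_line_path_in_cuntz_class
    {B : Type*} [NonUnitalCStarAlgebra B] [PartialOrder B] [StarOrderedRing B]
    (f b : B) (hf : 0 ≤ f) (hb : 0 ≤ b)
    (hmem : b ∈ herSet f) :
    (∀ t : ℝ, t ∈ Set.Ico (0 : ℝ) 1 → CuntzEquiv ((1 - t) • f + t • b) f) ∧
    (CuntzEquiv b f →
      ∀ t : ℝ, t ∈ Set.Icc (0 : ℝ) 1 → CuntzEquiv ((1 - t) • f + t • b) f) := by
  have main : ∀ t : ℝ, t ∈ Set.Ico (0 : ℝ) 1 → CuntzEquiv ((1 - t) • f + t • b) f := by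
    rintro t ⟨ht0, ht1⟩
    have h1t : 0 < 1 - t := sub_pos.mpr ht1
    have hf' : 0 ≤ (1 - t) • f := smul_nonneg h1t.le hf
    have hb' : 0 ≤ t • b := smul_nonneg ht0 hb
    have hh : 0 ≤ (1 - t) • f + t • b := add_nonneg hf' hb'
    refine ⟨cuntzLE_of_forall_le_smul_add hh hf fun ε hε => ?_,
      cuntzLE_of_forall_le_smul_add hf hh fun ε hε => ?_⟩
    · have htb : t • b ∈ herSet f := by
        refine map_mem_closure (continuous_const_smul t) hmem ?_
        rintro _ ⟨x, rfl⟩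
        exact ⟨t • x, by simp only [mul_smul_comm, smul_mul_assoc]⟩
      obtain ⟨C, hC, hle⟩ := exists_le_smul_add_of_mem_herSet hf hb'.isSelfAdjoint htb hε
      refine ⟨(1 - t) + C, by positivity, ?_⟩
      rw [add_smul, Unitization.inr_add, Unitization.inr_add, add_assoc]
      gcongr
    · refine ⟨(1 - t)⁻¹, by positivity, ?_⟩
      have h1 : f ≤ (1 - t)⁻¹ • ((1 - t) • f + t • b) := by
        rw [smul_add, smul_smul, inv_mul_cancel₀ h1t.ne', one_smul]
        exact le_add_of_nonneg_right (smul_nonneg (by positivity) hb')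
      have h2 : (0 : Unitization ℂ B) ≤ algebraMap ℝ _ ε := algebraMap_nonneg _ hε.le
      exact le_add_of_le_of_nonneg ((Unitization.inr_le_iff _ _ hf.isSelfAdjoint
        (smul_nonneg (by positivity) hh).isSelfAdjoint).mpr h1) h2
  refine ⟨main, fun hbf t ht => ?_⟩
  rcases ht.2.lt_or_eq with h | rfl
  · exact main t ⟨ht.1, h⟩
  · simpa using hbf
end
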